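/- arXiv:1404.5892 — 2 statements merged into one kernel-verified Lean document; each statement's English description precedes it below -/
import Mathlib

section
/- There exists a simple graph G that admits a planar poly-line drawing of height 6 but admits no planar y-monotone poly-line drawing of height 6. -/
open Set

noncomputable section

/-- Points of the plane. -/
abbrev Pt : Type := ℝ × ℝ

/-- The image (set of points) of a polygonal chain given by its list of breakpoints. -/
def chainSet : List Pt → Set Pt
  | [] => ∅
  | [p] => {p}
  | p :: q :: rest => segment ℝ p q ∪ chainSet (q :: rest)

/-- The bends (interior junction points) of a polygonal chain. -/
def chainBends (l : List Pt) : List Pt := (l.drop 1).dropLast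

/-- `S` is the image of a simple (injective) curve from `a` to `b`. -/
def IsSimpleArc (S : Set Pt) (a b : Pt) : Prop :=
  ∃ γ : ℝ → Pt, ContinuousOn γ (Icc (0:ℝ) 1) ∧ InjOn γ (Icc (0:ℝ) 1) ∧
    γ '' Icc (0:ℝ) 1 = S ∧ γ 0 = a ∧ γ 1 = b

/-- A poly-line drawing of a simple graph `G`: an injective placement of the vertices
together with, for each edge, a simple polygonal arc joining the endpoints. -/
structure PolyDrawing {V : Type} (G : SimpleGraph V) where
  pos : V → Pt
  pos_inj : Function.Injective pos
  arc : Sym2 V → List Pt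
  arc_ends : ∀ u v : V, G.Adj u v →
    ((arc s(u, v)).head? = some (pos u) ∧ (arc s(u, v)).getLast? = some (pos v)) ∨
    ((arc s(u, v)).head? = some (pos v) ∧ (arc s(u, v)).getLast? = some (pos u))
  arc_simple : ∀ u v : V, G.Adj u v →
    IsSimpleArc (chainSet (arc s(u, v))) (pos u) (pos v)

namespace PolyDrawing

variable {V : Type} {G : SimpleGraph V}

/-- The set of points used by the arc of an edge. -/
def edgePts (Γ : PolyDrawing G) (e : Sym2 V) : Set Pt := chainSet (Γ.arc e)

/-- Planarity: no vertex point lies on the arc of a non-incident edge, and arcs of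
distinct edges meet only in images of common endpoints. -/
def IsPlanar (Γ : PolyDrawing G) : Prop :=
  (∀ v : V, ∀ e ∈ G.edgeSet, v ∉ e → Γ.pos v ∉ Γ.edgePts e) ∧
  (∀ e ∈ G.edgeSet, ∀ f ∈ G.edgeSet, e ≠ f →
    ∀ p ∈ Γ.edgePts e ∩ Γ.edgePts f, ∃ w : V, w ∈ e ∧ w ∈ f ∧ p = Γ.pos w)

/-- `y`-monotone: along every edge arc the `y`-coordinate varies weakly monotonically. -/
def IsYMonotone (Γ : PolyDrawing G) : Prop :=
  ∀ e ∈ G.edgeSet,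
    List.Chain' (· ≤ ·) ((Γ.arc e).map Prod.snd) ∨
    List.Chain' (· ≥ ·) ((Γ.arc e).map Prod.snd)

/-- The drawing has height `h`: every vertex and every bend has an integer
`y`-coordinate in `{1, …, h}`. -/
def HasHeight (Γ : PolyDrawing G) (h : ℕ) : Prop :=
  (∀ v : V, ∃ k : ℤ, 1 ≤ k ∧ k ≤ (h : ℤ) ∧ (Γ.pos v).2 = (k : ℝ)) ∧
  (∀ e ∈ G.edgeSet, ∀ p ∈ chainBends (Γ.arc e), ∃ k : ℤ, 1 ≤ k ∧ k ≤ (h : ℤ) ∧ p.2 = (k : ℝ))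

/-- All vertices and bends have integer `y`-coordinates. -/
def IntegerY (Γ : PolyDrawing G) : Prop :=
  (∀ v : V, ∃ k : ℤ, (Γ.pos v).2 = (k : ℝ)) ∧
  (∀ e ∈ G.edgeSet, ∀ p ∈ chainBends (Γ.arc e), ∃ k : ℤ, p.2 = (k : ℝ))

/-- The set of all points of the drawing (vertex points and edge arcs). -/
def image (Γ : PolyDrawing G) : Set Pt :=
  Set.range Γ.pos ∪ ⋃ e ∈ G.edgeSet, Γ.edgePts e

/-- The union of the unbounded connected components of the complement of the drawing. -/
def outerRegion (Γ : PolyDrawing G) : Set Pt :=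
  {p | p ∉ Γ.image ∧ ¬ Bornology.IsBounded (connectedComponentIn Γ.imageᶜ p)}

/-- A vertex is inner if its point does not lie on the boundary of the unbounded
connected component of the complement of the drawing. -/
def IsInner (Γ : PolyDrawing G) (v : V) : Prop :=
  Γ.pos v ∉ frontier Γ.outerRegion

/-- Number of incoming edges at `v` (edges whose other endpoint is weakly below `v`;
horizontal edges count as incoming). -/
def indeg (Γ : PolyDrawing G) (v : V) : ℕ :=
  {w : V | G.Adj v w ∧ (Γ.pos w).2 ≤ (Γ.pos v).2}.ncard

/-- Number of outgoing edges at `v` (edges whose other endpoint is weakly above `v`;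
horizontal edges count as outgoing). -/
def outdeg (Γ : PolyDrawing G) (v : V) : ℕ :=
  {w : V | G.Adj v w ∧ (Γ.pos v).2 ≤ (Γ.pos w).2}.ncard

/-- The set of points drawn for an element (vertex or edge) of the graph. -/
def drawSet (Γ : PolyDrawing G) : V ⊕ ↥G.edgeSet → Set Pt
  | Sum.inl v => {Γ.pos v}
  | Sum.inr e => Γ.edgePts e

end PolyDrawing

/-- A straight-line drawing of a simple graph: an injective placement of the vertices;
each edge is drawn as the closed segment between its endpoints. -/
structure StraightDrawing {V : Type} (G : SimpleGraph V) where
  pos : V → Pt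
  pos_inj : Function.Injective pos

namespace StraightDrawing

variable {V : Type} {G : SimpleGraph V}

/-- The closed segment representing an edge. -/
def edgePts (Γ : StraightDrawing G) (e : Sym2 V) : Set Pt :=
  Sym2.lift ⟨fun u v => segment ℝ (Γ.pos u) (Γ.pos v),
    fun u v => segment_symm (𝕜 := ℝ) (Γ.pos u) (Γ.pos v)⟩ e

/-- Planarity of a straight-line drawing. -/
def IsPlanar (Γ : StraightDrawing G) : Prop :=
  (∀ v : V, ∀ e ∈ G.edgeSet, v ∉ e → Γ.pos v ∉ Γ.edgePts e) ∧
  (∀ e ∈ G.edgeSet, ∀ f ∈ G.edgeSet, e ≠ f →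
    ∀ p ∈ Γ.edgePts e ∩ Γ.edgePts f, ∃ w : V, w ∈ e ∧ w ∈ f ∧ p = Γ.pos w)

/-- Every vertex has an integer `y`-coordinate in `{1, …, h}`. -/
def HeightLe (Γ : StraightDrawing G) (h : ℕ) : Prop :=
  ∀ v : V, ∃ k : ℤ, 1 ≤ k ∧ k ≤ (h : ℤ) ∧ (Γ.pos v).2 = (k : ℝ)

/-- All vertices lie on integer grid points. -/
def IsGrid (Γ : StraightDrawing G) : Prop :=
  ∀ v : V, ∃ p : ℤ × ℤ, Γ.pos v = ((p.1 : ℝ), (p.2 : ℝ))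

/-- The set of points drawn for an element (vertex or edge) of the graph. -/
def drawSet (Γ : StraightDrawing G) : V ⊕ ↥G.edgeSet → Set Pt
  | Sum.inl v => {Γ.pos v}
  | Sum.inr e => Γ.edgePts e

end StraightDrawing

/-- The intersection of a set of points with the horizontal line `y = r`,
recorded as a set of `x`-coordinates. -/
def rowSlice (S : Set Pt) (r : ℝ) : Set ℝ := {x : ℝ | (x, r) ∈ S}

/-- Two drawings (given by the sets drawn for each vertex/edge element) have the same
left-to-right order in each row: for every integer row `r` and elements `a`, `b` both
meeting row `r` in both drawings, the drawing of `a` lies entirely strictly to the left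
of that of `b` in one drawing iff it does in the other. -/
def SameRowOrder {α : Type} (D D' : α → Set Pt) : Prop :=
  ∀ r : ℤ, ∀ a b : α,
    (rowSlice (D a) (r : ℝ)).Nonempty → (rowSlice (D b) (r : ℝ)).Nonempty →
    (rowSlice (D' a) (r : ℝ)).Nonempty → (rowSlice (D' b) (r : ℝ)).Nonempty →
    ((∀ x ∈ rowSlice (D a) (r : ℝ), ∀ y ∈ rowSlice (D b) (r : ℝ), x < y) ↔
     (∀ x ∈ rowSlice (D' a) (r : ℝ), ∀ y ∈ rowSlice (D' b) (r : ℝ), x < y))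

/-- A simple graph on `n ≥ 3` vertices is triangulated (maximal planar) if it admits a
planar poly-line drawing and has exactly `3n - 6` edges. -/
def IsTriangulated {V : Type} [Fintype V] (G : SimpleGraph V) : Prop :=
  3 ≤ Fintype.card V ∧ G.edgeSet.ncard = 3 * Fintype.card V - 6 ∧
  ∃ Γ : PolyDrawing G, Γ.IsPlanar

/-- Data of a flat visibility representation: a horizontal segment for every vertex
(given by its `y`-coordinate and left/right `x`-coordinates) and a segment (given by
its two endpoints) for every edge. -/
structure VisData (V : Type) where
  ly : V → ℝ
  lx : V → ℝ
  rx : V → ℝ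
  ep1 : Sym2 V → Pt
  ep2 : Sym2 V → Pt

/-- The horizontal segment of a vertex. -/
def VisData.vseg {V : Type} (D : VisData V) (v : V) : Set Pt :=
  segment ℝ (D.lx v, D.ly v) (D.rx v, D.ly v)

/-- The segment of an edge. -/
def VisData.eseg {V : Type} (D : VisData V) (e : Sym2 V) : Set Pt :=
  segment ℝ (D.ep1 e) (D.ep2 e)

/-- `D` is a planar flat visibility representation of `G` of height `h`. -/
def IsFlatVisRep {V : Type} (G : SimpleGraph V) (D : VisData V) (h : ℕ) : Prop :=
  (∀ v : V, D.lx v ≤ D.rx v) ∧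
  (∀ v : V, ∃ k : ℤ, 1 ≤ k ∧ k ≤ (h : ℤ) ∧ D.ly v = (k : ℝ)) ∧
  (∀ e ∈ G.edgeSet, (D.ep1 e).1 = (D.ep2 e).1 ∨ (D.ep1 e).2 = (D.ep2 e).2) ∧
  (∀ e ∈ G.edgeSet, ∀ p ∈ D.eseg e, 1 ≤ p.2 ∧ p.2 ≤ (h : ℝ)) ∧
  (∀ u v : V, G.Adj u v →
    (D.ep1 s(u, v) ∈ D.vseg u ∧ D.ep2 s(u, v) ∈ D.vseg v) ∨
    (D.ep1 s(u, v) ∈ D.vseg v ∧ D.ep2 s(u, v) ∈ D.vseg u)) ∧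
  (∀ u v : V, u ≠ v → Disjoint (D.vseg u) (D.vseg v)) ∧
  (∀ e ∈ G.edgeSet, ∀ w : V, ∀ p ∈ D.eseg e ∩ D.vseg w, p = D.ep1 e ∨ p = D.ep2 e) ∧
  (∀ e ∈ G.edgeSet, ∀ f ∈ G.edgeSet, e ≠ f → ∀ p ∈ D.eseg e ∩ D.eseg f,
    (p = D.ep1 e ∨ p = D.ep2 e) ∧ (p = D.ep1 f ∨ p = D.ep2 f))

end

/-- The combinatorial content of a planar drawing in which every edge is `y`-monotone: vertices
lie on integer levels, and an edge from `u` up to `v` meets level `r` at abscissa `c u v r`. -/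
structure LevelDrawing {V : Type} (G : SimpleGraph V) where
  lev : V → ℤ
  x : V → ℝ
  c : V → V → ℤ → ℝ
  inj : ∀ u v, lev u = lev v → x u = x v → u = v
  c_bot : ∀ u v, G.Adj u v → lev u < lev v → c u v (lev u) = x u
  c_top : ∀ u v, G.Adj u v → lev u < lev v → c u v (lev v) = x v
  vertex_on : ∀ u v w r, G.Adj u v → lev u < lev v → lev u ≤ r → r ≤ lev v → lev w = r →
    c u v r = x w → w = u ∨ w = v
  edge_on : ∀ u v p q r, G.Adj u v → lev u < lev v → lev u ≤ r → r ≤ lev v →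
    G.Adj p q → lev p < lev q → lev p ≤ r → r ≤ lev q → c u v r = c p q r →
    u = p ∨ u = q ∨ v = p ∨ v = q
  noncrossing : ∀ u v p q r, G.Adj u v → lev u ≤ r → r < lev v →
    G.Adj p q → lev p ≤ r → r < lev q → c u v r < c p q r → c u v (r + 1) ≤ c p q (r + 1)
  no_vertex_between : ∀ u v w, G.Adj u v → lev u = lev v → lev w = lev v →
    x u < x w → ¬ x w < x v
  no_edge_between : ∀ u v p q r, G.Adj u v → lev u = r → lev v = r →
    G.Adj p q → lev p < lev q → lev p ≤ r → r ≤ lev q → x u < c p q r → ¬ c p q r < x v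

namespace LevelDrawing

variable {V : Type} {G : SimpleGraph V} (D : LevelDrawing G)

/-- Reflection of a level drawing in a horizontal line. -/
def flip : LevelDrawing G where
  lev v := - D.lev v
  x := D.x
  c u v r := D.c v u (-r)
  inj u v h := D.inj u v (by linarith)
  c_bot u v h hl := by simpa using D.c_top v u h.symm (by linarith)
  c_top u v h hl := by simpa using D.c_bot v u h.symm (by linarith)
  vertex_on u v w r h hl h1 h2 hw hc :=
    (D.vertex_on v u w (-r) h.symm (by linarith) (by linarith) (by linarith) (by linarith) hc).symm
  edge_on u v p q r h hl h1 h2 h' hl' h1' h2' hc := by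
    have := D.edge_on v u q p (-r) h.symm (by linarith) (by linarith) (by linarith)
      h'.symm (by linarith) (by linarith) (by linarith) hc
    tauto
  noncrossing u v p q r h h1 h2 h' h1' h2' hc := by
    by_contra hcon
    have := D.noncrossing q p v u (-(r + 1)) h'.symm (by linarith) (by linarith)
      h.symm (by linarith) (by linarith) (not_le.mp hcon)
    have hr : -(r + 1) + 1 = -r := by ring
    rw [hr] at this
    linarith
  no_vertex_between u v w h hl hw := D.no_vertex_between u v w h (by linarith) (by linarith)
  no_edge_between u v p q r h hu hv h' hl h1 h2 :=
    D.no_edge_between u v q p (-r) h (by linarith) (by linarith) h'.symm (by linarith)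
      (by linarith) (by linarith)

/-- The level drawing induced on a subgraph. -/
def comap {U : Type} {H : SimpleGraph U} (f : H →g G) (hf : Function.Injective f) :
    LevelDrawing H where
  lev v := D.lev (f v)
  x v := D.x (f v)
  c u v r := D.c (f u) (f v) r
  inj u v h h' := hf (D.inj _ _ h h')
  c_bot u v h := D.c_bot _ _ (f.map_rel h)
  c_top u v h := D.c_top _ _ (f.map_rel h)
  vertex_on u v w r h hl h1 h2 hw hc := by
    have := D.vertex_on _ _ (f w) r (f.map_rel h) hl h1 h2 hw hc
    simpa only [hf.eq_iff] using this
  edge_on u v p q r h hl h1 h2 h' hl' h1' h2' hc := by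
    have := D.edge_on _ _ _ _ r (f.map_rel h) hl h1 h2 (f.map_rel h') hl' h1' h2' hc
    simpa only [hf.eq_iff] using this
  noncrossing u v p q r h h1 h2 h' := D.noncrossing _ _ _ _ r (f.map_rel h) h1 h2 (f.map_rel h')
  no_vertex_between u v w h := D.no_vertex_between _ _ _ (f.map_rel h)
  no_edge_between u v p q r h hu hv h' := D.no_edge_between _ _ _ _ r (f.map_rel h) hu hv
    (f.map_rel h')

/-- Indicator that the edge from `u` up to `v` leaves level `r` upwards, left of `z`. -/
noncomputable def above (r : ℤ) (z : ℝ) (u v : V) : ZMod 2 :=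
  open Classical in if D.lev u ≤ r ∧ r < D.lev v ∧ D.c u v r < z then 1 else 0

/-- Indicator that the edge from `u` up to `v` reaches level `r` from below, left of `z`. -/
noncomputable def below (r : ℤ) (z : ℝ) (u v : V) : ZMod 2 :=
  open Classical in if D.lev u < r ∧ r ≤ D.lev v ∧ D.c u v r < z then 1 else 0

/-- Indicator that the vertex `v` is on level `r`, left of `z`. -/
noncomputable def left (r : ℤ) (z : ℝ) (v : V) : ZMod 2 :=
  open Classical in if D.lev v = r ∧ D.x v < z then 1 else 0

/-- Parity of the number of steps of a walk leaving level `r` upwards, left of `z`. -/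
noncomputable def aboveSum {a b : V} (p : G.Walk a b) (r : ℤ) (z : ℝ) : ZMod 2 :=
  (p.darts.map fun d => D.above r z d.fst d.snd + D.above r z d.snd d.fst).sum

/-- Parity of the number of steps of a walk reaching level `r` from below, left of `z`. -/
noncomputable def belowSum {a b : V} (p : G.Walk a b) (r : ℤ) (z : ℝ) : ZMod 2 :=
  (p.darts.map fun d => D.below r z d.fst d.snd + D.below r z d.snd d.fst).sum

theorem add_self_zmod_two (a : ZMod 2) : a + a = 0 := CharTwo.add_self_eq_zero a

theorem aboveSum_append {a b d : V} (p : G.Walk a b) (q : G.Walk b d) (r : ℤ) (z : ℝ) :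
    D.aboveSum (p.append q) r z = D.aboveSum p r z + D.aboveSum q r z := by
  simp [aboveSum, SimpleGraph.Walk.darts_append]

theorem aboveSum_reverse {a b : V} (p : G.Walk a b) (r : ℤ) (z : ℝ) :
    D.aboveSum p.reverse r z = D.aboveSum p r z := by
  unfold aboveSum
  rw [SimpleGraph.Walk.darts_reverse, List.map_reverse, List.sum_reverse, List.map_map]
  congr 1
  refine List.map_congr_left fun d _ => ?_
  simp [add_comm]

theorem step_above_add_below {u v : V} (h : G.Adj u v) (r : ℤ) (z : ℝ)
    (hz : D.lev u = r → D.lev v = r → (D.x u < z ↔ D.x v < z)) :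
    (D.above r z u v + D.above r z v u) + (D.below r z u v + D.below r z v u) =
      D.left r z u + D.left r z v := by
  have key : ∀ u v : V, G.Adj u v → D.lev u < D.lev v →
      (D.above r z u v + D.above r z v u) + (D.below r z u v + D.below r z v u) =
      D.left r z u + D.left r z v := by
    intro u v h hl
    have hb := D.c_bot u v h hl
    have ht := D.c_top u v h hl
    have e1 : D.above r z v u = 0 := if_neg (by rintro ⟨h1, h2, -⟩; linarith)
    have e2 : D.below r z v u = 0 := if_neg (by rintro ⟨h1, h2, -⟩; linarith)
    rw [e1, e2, add_zero, add_zero]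
    unfold above below left
    rcases lt_trichotomy (D.lev u) r with h1 | h1 | h1
    · rcases lt_trichotomy (D.lev v) r with h2 | h2 | h2
      · rw [if_neg (by omega), if_neg (by omega), if_neg (by omega), if_neg (by omega)]
      · subst h2
        simp [h1, h1.ne, ht]
      · simp only [h1, h1.le, h2, h2.le, h1.ne, h2.ne', true_and, false_and, if_false]
        rw [add_self_zmod_two, add_zero]
    · subst h1
      simp [hl, hl.ne', hb]
    · rw [if_neg (by omega), if_neg (by omega), if_neg (by omega), if_neg (by omega)]
  rcases lt_trichotomy (D.lev u) (D.lev v) with hl | hl | hl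
  · exact key u v h hl
  · have e1 : D.above r z u v = 0 := if_neg (by rintro ⟨h1, h2, -⟩; linarith)
    have e2 : D.below r z u v = 0 := if_neg (by rintro ⟨h1, h2, -⟩; linarith)
    have e3 : D.above r z v u = 0 := if_neg (by rintro ⟨h1, h2, -⟩; linarith)
    have e4 : D.below r z v u = 0 := if_neg (by rintro ⟨h1, h2, -⟩; linarith)
    have e5 : D.left r z u = D.left r z v := by
      unfold left
      by_cases hr : D.lev u = r
      · simp only [hr, ← hl, hz hr (hl ▸ hr)]
      · rw [if_neg (by tauto), if_neg (by rw [← hl]; tauto)]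
    rw [e1, e2, e3, e4, e5, add_self_zmod_two, add_self_zmod_two]
  · rw [add_comm (D.left r z u), ← key v u h.symm hl]
    ring

theorem aboveSum_add_belowSum {a b : V} (p : G.Walk a b) (r : ℤ) (z : ℝ)
    (hz : ∀ u v, u ∈ p.support → v ∈ p.support → G.Adj u v → D.lev u = r → D.lev v = r →
      (D.x u < z ↔ D.x v < z)) :
    D.aboveSum p r z + D.belowSum p r z = D.left r z a + D.left r z b := by
  induction p with
  | nil => simp [aboveSum, belowSum, add_self_zmod_two]
  | @cons u v w h p ih =>
    have h1 := D.step_above_add_below h r z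
      (hz u v (by simp) (by simp) h)
    have h2 := ih fun u' v' hu hv => hz u' v' (by simp [hu]) (by simp [hv])
    have h3 := add_self_zmod_two (D.left r z v)
    simp only [aboveSum, belowSum, SimpleGraph.Walk.darts_cons, List.map_cons, List.sum_cons]
      at h2 ⊢
    linear_combination h1 + h2 + h3

theorem sum_map_darts_congr {a b : V} (p : G.Walk a b) (f g : V → V → ZMod 2)
    (h : ∀ u v, u ∈ p.support → v ∈ p.support → G.Adj u v → f u v = g u v) :
    (p.darts.map fun d => f d.fst d.snd + f d.snd d.fst).sum =
      (p.darts.map fun d => g d.fst d.snd + g d.snd d.fst).sum := by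
  congr 1
  refine List.map_congr_left fun d hd => ?_
  have h1 := p.dart_fst_mem_support_of_mem_darts hd
  have h2 := p.dart_snd_mem_support_of_mem_darts hd
  rw [h _ _ h1 h2 d.adj, h _ _ h2 h1 d.adj.symm]

theorem above_eq_below {u v p q : V} (h : G.Adj u v) (hf : G.Adj p q) (hup : u ≠ p) (huq : u ≠ q)
    (hvp : v ≠ p) (hvq : v ≠ q) {r : ℤ} (h1 : D.lev p ≤ r) (h2 : r < D.lev q) :
    D.above r (D.c p q r) u v = D.below (r + 1) (D.c p q (r + 1)) u v := by
  unfold above below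
  by_cases hs : D.lev u ≤ r ∧ r < D.lev v
  · obtain ⟨h3, h4⟩ := hs
    have n1 : D.c u v r ≠ D.c p q r := fun he => by
      have := D.edge_on u v p q r h (by linarith) h3 h4.le hf (by linarith) h1 h2.le he
      tauto
    have n2 : D.c u v (r + 1) ≠ D.c p q (r + 1) := fun he => by
      have := D.edge_on u v p q (r + 1) h (by linarith) (by linarith) h4 hf (by linarith)
        (by linarith) h2 he
      tauto
    have : D.c u v r < D.c p q r ↔ D.c u v (r + 1) < D.c p q (r + 1) := by
      constructor
      · intro hlt
        exact lt_of_le_of_ne (D.noncrossing u v p q r h h3 h4 hf h1 h2 hlt) n2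
      · intro hlt
        by_contra hcon
        have := D.noncrossing p q u v r hf h1 h2 h h3 h4 (lt_of_le_of_ne (not_lt.mp hcon) n1.symm)
        linarith
    have e1 : D.lev u < r + 1 := by linarith
    have e2 : r + 1 ≤ D.lev v := h4
    simp only [h3, h4, e1, e2, this, true_and]
  · rw [if_neg (by tauto), if_neg (by
      rintro ⟨h3, h4, -⟩
      exact hs ⟨by linarith, by linarith⟩)]

theorem lt_iff_of_horizontal_edge {u v p q : V} (h : G.Adj u v) (hf : G.Adj p q) (hup : u ≠ p)
    (huq : u ≠ q) (hvp : v ≠ p) (hvq : v ≠ q) {r : ℤ} (h1 : D.lev p < D.lev q)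
    (h2 : D.lev p ≤ r) (h3 : r ≤ D.lev q) (hu : D.lev u = r) (hv : D.lev v = r) :
    D.x u < D.c p q r ↔ D.x v < D.c p q r := by
  have n1 : D.c p q r ≠ D.x u := fun he => by
    have := D.vertex_on p q u r hf h1 h2 h3 hu he
    tauto
  have n2 : D.c p q r ≠ D.x v := fun he => by
    have := D.vertex_on p q v r hf h1 h2 h3 hv he
    tauto
  constructor
  · intro hlt
    by_contra hcon
    exact D.no_edge_between u v p q r h hu hv hf h1 h2 h3 hlt
      (lt_of_le_of_ne (not_lt.mp hcon) n2)
  · intro hlt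
    by_contra hcon
    exact D.no_edge_between v u p q r h.symm hv hu hf h1 h2 h3 hlt
      (lt_of_le_of_ne (not_lt.mp hcon) n1)

theorem lt_iff_of_horizontal_vertex {u v w : V} (h : G.Adj u v) (hu : D.lev u = D.lev w)
    (hv : D.lev v = D.lev w) (huw : u ≠ w) (hvw : v ≠ w) :
    D.x u < D.x w ↔ D.x v < D.x w := by
  have n1 : D.x u ≠ D.x w := fun he => huw (D.inj _ _ hu he)
  have n2 : D.x v ≠ D.x w := fun he => hvw (D.inj _ _ hv he)
  constructor
  · intro hlt
    by_contra hcon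
    exact D.no_vertex_between u v w h (by linarith) (by linarith) hlt
      (lt_of_le_of_ne (not_lt.mp hcon) n2.symm)
  · intro hlt
    by_contra hcon
    exact D.no_vertex_between v u w h.symm (by linarith) (by linarith) hlt
      (lt_of_le_of_ne (not_lt.mp hcon) n1.symm)

/-- The side of `w` with respect to a walk between two bottom vertices. -/
noncomputable def side {a b : V} (p : G.Walk a b) (w : V) : ZMod 2 := D.aboveSum p (D.lev w) (D.x w)

theorem side_eq_of_lt {a b : V} (p : G.Walk a b) {lo : ℤ} (ha : D.lev a = lo) (hb : D.lev b = lo)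
    {w w' : V} (h : G.Adj w w') (hw : w ∉ p.support) (hw' : w' ∉ p.support) (hlo : lo ≤ D.lev w)
    (hl : D.lev w < D.lev w') : D.side p w = D.side p w' := by
  have hne : ∀ u ∈ p.support, u ≠ w ∧ u ≠ w' := fun u hu =>
    ⟨fun he => hw (he ▸ hu), fun he => hw' (he ▸ hu)⟩
  have key : ∀ n : ℕ, D.lev w + n ≤ D.lev w' →
      D.aboveSum p (D.lev w + n) (D.c w w' (D.lev w + n)) = D.side p w := by
    intro n
    induction n with
    | zero => intro _; simp [side, D.c_bot w w' h hl]
    | succ n ih =>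
      intro hn
      push_cast at hn
      have hr : D.lev w + ((n + 1 : ℕ) : ℤ) = D.lev w + n + 1 := by push_cast; ring
      rw [hr, ← ih (by linarith)]
      have e1 : D.aboveSum p (D.lev w + n) (D.c w w' (D.lev w + n)) =
          D.belowSum p (D.lev w + n + 1) (D.c w w' (D.lev w + n + 1)) :=
        sum_map_darts_congr p _ _ fun u v hu hv huv =>
          D.above_eq_below huv h (hne u hu).1 (hne u hu).2 (hne v hv).1 (hne v hv).2
            (by linarith) (by linarith)
      have e2 := D.aboveSum_add_belowSum p (D.lev w + n + 1) (D.c w w' (D.lev w + n + 1))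
        fun u v hu hv huv hu' hv' =>
          D.lt_iff_of_horizontal_edge huv h (hne u hu).1 (hne u hu).2 (hne v hv).1 (hne v hv).2
            hl (by linarith) (by linarith) hu' hv'
      have e3 : D.left (D.lev w + n + 1) (D.c w w' (D.lev w + n + 1)) a = 0 :=
        if_neg (by rintro ⟨h1, -⟩; linarith)
      have e4 : D.left (D.lev w + n + 1) (D.c w w' (D.lev w + n + 1)) b = 0 :=
        if_neg (by rintro ⟨h1, -⟩; linarith)
      rw [e1]
      rw [e3, e4] at e2
      exact CharTwo.add_eq_zero.mp (by simpa using e2)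
  have := key (D.lev w' - D.lev w).toNat (by rw [Int.toNat_of_nonneg (by linarith)]; linarith)
  rw [Int.toNat_of_nonneg (by linarith), add_sub_cancel, D.c_top w w' h hl] at this
  exact this.symm

theorem side_eq_of_horizontal {a b : V} (p : G.Walk a b) {w w' : V} (h : G.Adj w w')
    (hw : w ∉ p.support) (hw' : w' ∉ p.support) (hl : D.lev w = D.lev w') :
    D.side p w = D.side p w' := by
  have hne : ∀ u ∈ p.support, u ≠ w ∧ u ≠ w' := fun u hu =>
    ⟨fun he => hw (he ▸ hu), fun he => hw' (he ▸ hu)⟩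
  unfold side
  rw [← hl]
  refine sum_map_darts_congr p _ _ fun u v hu hv huv => ?_
  unfold above
  by_cases hs : D.lev u ≤ D.lev w ∧ D.lev w < D.lev v
  · obtain ⟨h1, h2⟩ := hs
    have n1 : D.c u v (D.lev w) ≠ D.x w := fun he => by
      have := D.vertex_on u v w _ huv (by linarith) h1 h2.le rfl he
      have := (hne u hu).1
      have := (hne v hv).1
      tauto
    have n2 : D.c u v (D.lev w) ≠ D.x w' := fun he => by
      have := D.vertex_on u v w' _ huv (by linarith) h1 h2.le hl.symm he
      have := (hne u hu).2
      have := (hne v hv).2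
      tauto
    have : D.c u v (D.lev w) < D.x w ↔ D.c u v (D.lev w) < D.x w' := by
      constructor
      · intro hlt
        by_contra hcon
        exact D.no_edge_between w' w u v _ h.symm hl.symm rfl huv (by linarith) h1 h2.le
          (lt_of_le_of_ne (not_lt.mp hcon) n2.symm) hlt
      · intro hlt
        by_contra hcon
        exact D.no_edge_between w w' u v _ h rfl hl.symm huv (by linarith) h1 h2.le
          (lt_of_le_of_ne (not_lt.mp hcon) n1.symm) hlt
    simp only [this]
  · rw [if_neg (by tauto), if_neg (by tauto)]

theorem side_eq_of_walk {a b : V} (p : G.Walk a b) {lo : ℤ} (ha : D.lev a = lo)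
    (hb : D.lev b = lo) {w w' : V} (q : G.Walk w w') (hq : ∀ v ∈ q.support, v ∉ p.support)
    (hlo : ∀ v ∈ q.support, lo ≤ D.lev v) : D.side p w = D.side p w' := by
  induction q with
  | nil => rfl
  | @cons u v w h q ih =>
    rw [← ih (fun v hv => hq v (by simp [hv])) fun v hv => hlo v (by simp [hv])]
    have hu := hq u (by simp)
    have hv := hq v (by simp)
    rcases lt_trichotomy (D.lev u) (D.lev v) with hl | hl | hl
    · exact D.side_eq_of_lt p ha hb h hu hv (hlo u (by simp)) hl
    · exact D.side_eq_of_horizontal p h hu hv hl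
    · exact (D.side_eq_of_lt p ha hb h.symm hv hu (hlo v (by simp)) hl).symm

theorem side_of_bottom {a b : V} (p : G.Walk a b) {lo : ℤ}
    (hp : ∀ v ∈ p.support, lo ≤ D.lev v) {w : V} (hw : D.lev w = lo) (hwp : w ∉ p.support) :
    D.side p w = D.left lo (D.x w) a + D.left lo (D.x w) b := by
  have hne : ∀ u ∈ p.support, u ≠ w := fun u hu he => hwp (he ▸ hu)
  subst hw
  have e := D.aboveSum_add_belowSum p (D.lev w) (D.x w) fun u v hu hv huv hu' hv' =>
    D.lt_iff_of_horizontal_vertex huv hu' hv' (hne u hu) (hne v hv)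
  have e0 : D.belowSum p (D.lev w) (D.x w) = 0 := by
    have := sum_map_darts_congr p (D.below (D.lev w) (D.x w)) (fun _ _ => 0)
      fun u v hu hv huv => if_neg (by
        rintro ⟨h1, -⟩
        have := hp u hu
        linarith)
    simpa [belowSum] using this
  rw [e0, add_zero] at e
  exact e

theorem side_of_top {a b : V} (p : G.Walk a b) {hi : ℤ}
    (hp : ∀ v ∈ p.support, D.lev v ≤ hi) {w : V} (hw : D.lev w = hi) : D.side p w = 0 := by
  have := sum_map_darts_congr p (D.above (D.lev w) (D.x w)) (fun _ _ => 0)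
    fun u v hu hv huv => if_neg (by
      rintro ⟨-, h1, -⟩
      have := hp v hv
      linarith)
  simpa [side, aboveSum] using this

theorem left_add_left {lo : ℤ} {u v : V} (hu : D.lev u = lo) (hv : D.lev v = lo) (h : u ≠ v) :
    D.left lo (D.x u) v + D.left lo (D.x v) u = 1 := by
  have hne : D.x u ≠ D.x v := fun he => h (D.inj _ _ (by rw [hu, hv]) he)
  unfold left
  rcases lt_or_gt_of_ne hne with hlt | hlt
  · simp [hu, hv, hlt, hlt.le]
  · simp [hu, hv, hlt, hlt.le]

theorem false_of_three_to_bottom {A B : V} (a : Fin 3 → V) (T : ∀ i, G.Walk A (a i))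
    (R : ∀ i, G.Walk B (a i)) {lo : ℤ} (ha : ∀ i, D.lev (a i) = lo)
    (hT : ∀ i, ∀ v ∈ (T i).support, lo ≤ D.lev v) (hR : ∀ i, ∀ v ∈ (R i).support, lo ≤ D.lev v)
    (hTR : ∀ i j, i ≠ j → ∀ v ∈ (T i).support, v ∉ (R j).support) : False := by
  have hne : ∀ i j, i ≠ j → a i ≠ a j := fun i j hij he =>
    hTR i j hij (a i) (T i).end_mem_support (by rw [he]; exact (R j).end_mem_support)
  have key : ∀ i j k, i ≠ k → j ≠ k → D.side (T i) B + D.side (T j) B =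
      D.left lo (D.x (a k)) (a i) + D.left lo (D.x (a k)) (a j) := by
    intro i j k hik hjk
    have hsup : ∀ v, v ∈ ((T i).reverse.append (T j)).support →
        v ∈ (T i).support ∨ v ∈ (T j).support := by
      intro v hv
      simpa [SimpleGraph.Walk.mem_support_append_iff] using hv
    have hd : ∀ v ∈ (R k).support, v ∉ ((T i).reverse.append (T j)).support := by
      intro v hv hv'
      rcases hsup v hv' with h | h
      · exact hTR i k hik v h hv
      · exact hTR j k hjk v h hv
    have h1 := D.side_eq_of_walk ((T i).reverse.append (T j)) (ha i) (ha j) (R k) hd (hR k)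
    have h2 := D.side_of_bottom ((T i).reverse.append (T j)) (lo := lo)
      (fun v hv => (hsup v hv).elim (hT i v) (hT j v)) (ha k) (hd _ (R k).end_mem_support)
    rw [← h2, ← h1]
    simp only [side, aboveSum_append, aboveSum_reverse]
  have h1 := key 0 1 2 (by decide) (by decide)
  have h2 := key 0 2 1 (by decide) (by decide)
  have h3 := key 1 2 0 (by decide) (by decide)
  have h4 := D.left_add_left (ha 0) (ha 1) (hne 0 1 (by decide))
  have h5 := D.left_add_left (ha 0) (ha 2) (hne 0 2 (by decide))
  have h6 := D.left_add_left (ha 1) (ha 2) (hne 1 2 (by decide))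
  have two : (2 : ZMod 2) = 0 := rfl
  have : (1 : ZMod 2) = 0 := by
    linear_combination -h1 - h2 - h3 - h4 - h5 - h6 +
      (D.side (T 0) B + D.side (T 1) B + D.side (T 2) B - 1) * two
  exact one_ne_zero this

theorem false_of_three_spanning {A : V} (a b : Fin 3 → V) (T : ∀ i, G.Walk A (a i))
    (Q : ∀ i, G.Walk (a i) (b i)) {lo hi : ℤ} (ha : ∀ i, D.lev (a i) = lo)
    (hb : ∀ i, D.lev (b i) = hi)
    (hT : ∀ i, ∀ v ∈ (T i).support, lo ≤ D.lev v ∧ D.lev v ≤ hi)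
    (hQ : ∀ i, ∀ v ∈ (Q i).support, lo ≤ D.lev v)
    (hTQ : ∀ i j, i ≠ j → ∀ v ∈ (T i).support, v ∉ (Q j).support) : False := by
  have hne : ∀ i j, i ≠ j → a i ≠ a j := fun i j hij he =>
    hTQ i j hij (a i) (T i).end_mem_support (by rw [he]; exact (Q j).start_mem_support)
  have key : ∀ i j k, i ≠ k → j ≠ k →
      D.left lo (D.x (a k)) (a i) + D.left lo (D.x (a k)) (a j) = 0 := by
    intro i j k hik hjk
    have hsup : ∀ v, v ∈ ((T i).reverse.append (T j)).support →
        v ∈ (T i).support ∨ v ∈ (T j).support := by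
      intro v hv
      simpa [SimpleGraph.Walk.mem_support_append_iff] using hv
    have hd : ∀ v ∈ (Q k).support, v ∉ ((T i).reverse.append (T j)).support := by
      intro v hv hv'
      rcases hsup v hv' with h | h
      · exact hTQ i k hik v h hv
      · exact hTQ j k hjk v h hv
    have h1 := D.side_eq_of_walk ((T i).reverse.append (T j)) (ha i) (ha j) (Q k) hd (hQ k)
    have h2 := D.side_of_bottom ((T i).reverse.append (T j)) (lo := lo)
      (fun v hv => (hsup v hv).elim (fun h => (hT i v h).1) fun h => (hT j v h).1) (ha k)
      (hd _ (Q k).start_mem_support)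
    rw [← h2, h1]
    exact D.side_of_top _ (fun v hv => (hsup v hv).elim (fun h => (hT i v h).2)
      fun h => (hT j v h).2) (hb k)
  have h1 := key 0 1 2 (by decide) (by decide)
  have h2 := key 0 2 1 (by decide) (by decide)
  have h3 := key 1 2 0 (by decide) (by decide)
  have h4 := D.left_add_left (ha 0) (ha 1) (hne 0 1 (by decide))
  have h5 := D.left_add_left (ha 0) (ha 2) (hne 0 2 (by decide))
  have h6 := D.left_add_left (ha 1) (ha 2) (hne 1 2 (by decide))
  have two : (2 : ZMod 2) = 0 := rfl
  have : (1 : ZMod 2) = 0 := by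
    linear_combination h1 + h2 + h3 - h4 - h5 - h6 - two
  exact one_ne_zero this

end LevelDrawing

/-- Seven disjoint copies of `G`, and two poles; pole `s` is joined to the copies of `M s`. -/
def polarGraph {X : Type} (G : SimpleGraph X) (M : Bool → Set X) :
    SimpleGraph (Bool ⊕ Fin 7 × X) where
  Adj
    | .inl _, .inl _ => False
    | .inl s, .inr p => p.2 ∈ M s
    | .inr p, .inl s => p.2 ∈ M s
    | .inr p, .inr q => p.1 = q.1 ∧ G.Adj p.2 q.2
  symm := ⟨by
    rintro (s | p) (t | q) h
    · exact h
    · exact h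
    · exact h
    · exact ⟨h.1.symm, h.2.symm⟩⟩
  loopless := ⟨by
    rintro (s | p) h
    · exact h
    · exact G.loopless.irrefl _ h.2⟩

namespace polarGraph

variable {X : Type} {G : SimpleGraph X} {M : Bool → Set X}

/-- The inclusion of the `i`-th copy. -/
def copy (i : Fin 7) : G →g polarGraph G M where
  toFun x := .inr (i, x)
  map_rel' h := ⟨rfl, h⟩

theorem copy_injective (i : Fin 7) : Function.Injective (copy (G := G) (M := M) i) :=
  fun _ _ h => (Prod.mk.inj (Sum.inr.inj h)).2

theorem exists_walk_copy (hG : G.Connected) (i : Fin 7) (x y : X) :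
    ∃ p : (polarGraph G M).Walk (.inr (i, x)) (.inr (i, y)),
      ∀ v ∈ p.support, ∃ z, v = .inr (i, z) := by
  obtain ⟨p⟩ := hG.preconnected x y
  refine ⟨p.map (copy (M := M) i), fun v hv => ?_⟩
  have hv := (SimpleGraph.Walk.support_map (copy (M := M) i) p) ▸ hv
  rw [List.mem_map] at hv
  obtain ⟨z, -, rfl⟩ := hv
  exact ⟨z, rfl⟩

theorem exists_walk_pole (hG : G.Connected) {s : Bool} (hM : (M s).Nonempty) (i : Fin 7) (x : X) :
    ∃ p : (polarGraph G M).Walk (.inl s) (.inr (i, x)),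
      ∀ v ∈ p.support, v = .inl s ∨ ∃ z, v = .inr (i, z) := by
  obtain ⟨y, hy⟩ := hM
  obtain ⟨p, hp⟩ := exists_walk_copy (M := M) hG i y x
  have h : (polarGraph G M).Adj (.inl s) (.inr (i, y)) := hy
  refine ⟨.cons h p, fun v hv => ?_⟩
  rw [SimpleGraph.Walk.support_cons, List.mem_cons] at hv
  exact hv.imp id (hp v)

theorem connected (hG : G.Connected) (hM : ∀ s, (M s).Nonempty) :
    (polarGraph G M).Connected := by
  obtain ⟨x⟩ := hG.nonempty
  have h0 : ∀ s i y, (polarGraph G M).Reachable (.inl s) (.inr (i, y)) := fun s i y =>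
    ⟨(exists_walk_pole hG (hM s) i y).choose⟩
  have h1 : ∀ v, (polarGraph G M).Reachable (.inl true) v := by
    rintro (s | ⟨i, y⟩)
    · exact (h0 true 0 x).trans (h0 s 0 x).symm
    · exact h0 true i y
  have : Nonempty (Bool ⊕ Fin 7 × X) := ⟨.inl true⟩
  exact ⟨fun u v => (h1 u).symm.trans (h1 v)⟩

variable (D : LevelDrawing (polarGraph G M))

theorem false_of_three_touch (hG : G.Connected) (hM : ∀ s, (M s).Nonempty) {f : Fin 3 → Fin 7}
    (hf : Function.Injective f) {lo : ℤ} (hp : ∀ s, lo ≤ D.lev (.inl s))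
    (hc : ∀ i x, lo ≤ D.lev (.inr (f i, x))) (ht : ∀ i, ∃ x, D.lev (.inr (f i, x)) = lo) :
    False := by
  choose x hx using ht
  choose T hT using fun (s : Bool) (i : Fin 3) => exists_walk_pole hG (hM s) (f i) (x i)
  have hlo : ∀ s i, ∀ v ∈ (T s i).support, lo ≤ D.lev v := by
    intro s i v hv
    obtain rfl | ⟨z, rfl⟩ := hT s i v hv
    · exact hp s
    · exact hc i z
  refine D.false_of_three_to_bottom (fun i => .inr (f i, x i)) (T true) (T false) hx
    (hlo true) (hlo false) fun i j hij v hv hv' => ?_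
  obtain rfl | ⟨z, rfl⟩ := hT _ _ v hv
  · obtain h | ⟨z, h⟩ := hT _ _ _ hv'
    · simp at h
    · simp at h
  · obtain h | ⟨z, h⟩ := hT _ _ _ hv'
    · simp at h
    · simp only [Sum.inr.injEq, Prod.mk.injEq] at h
      exact hij (hf h.1)

theorem false_of_three_span (hG : G.Connected) (hM : ∀ s, (M s).Nonempty) {f : Fin 3 → Fin 7}
    (hf : Function.Injective f) {lo hi : ℤ} {s : Bool} (hs : lo ≤ D.lev (.inl s))
    (hs' : D.lev (.inl s) ≤ hi) (hc : ∀ i x, lo ≤ D.lev (.inr (f i, x)))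
    (hc' : ∀ i x, D.lev (.inr (f i, x)) ≤ hi) (hb : ∀ i, ∃ x, D.lev (.inr (f i, x)) = lo)
    (ht : ∀ i, ∃ x, D.lev (.inr (f i, x)) = hi) : False := by
  choose x hx using hb
  choose y hy using ht
  choose T hT using fun i : Fin 3 => exists_walk_pole hG (hM s) (f i) (x i)
  choose Q hQ using fun i : Fin 3 => exists_walk_copy (M := M) hG (f i) (x i) (y i)
  refine D.false_of_three_spanning _ _ T Q hx hy (fun i v hv => ?_) (fun i v hv => ?_)
    fun i j hij v hv hv' => ?_
  · obtain rfl | ⟨z, rfl⟩ := hT i v hv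
    · exact ⟨hs, hs'⟩
    · exact ⟨hc i z, hc' i z⟩
  · obtain ⟨z, rfl⟩ := hQ i v hv
    exact hc i z
  · obtain ⟨z, rfl⟩ := hQ _ _ hv'
    obtain h | ⟨z, h⟩ := hT _ _ hv
    · simp at h
    · simp only [Sum.inr.injEq, Prod.mk.injEq] at h
      exact hij (hf h.1).symm

theorem card_touch_le_two (hG : G.Connected) (hM : ∀ s, (M s).Nonempty) {lo : ℤ}
    (hlo : ∀ v, lo ≤ D.lev v) (S : Finset (Fin 7))
    (hS : ∀ i ∈ S, ∃ x, D.lev (.inr (i, x)) = lo) : S.card ≤ 2 := by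
  by_contra! h
  let f := S.orderEmbOfCardLe h
  exact false_of_three_touch D hG hM (f := f) f.injective (fun s => hlo _) (fun i x => hlo _)
    fun i => hS _ (S.orderEmbOfCardLe_mem h i)

theorem exists_three_inner (hG : G.Connected) (hM : ∀ s, (M s).Nonempty) {lo hi : ℤ}
    (hlo : ∀ v, lo ≤ D.lev v) (hhi : ∀ v, D.lev v ≤ hi) :
    ∃ f : Fin 3 → Fin 7, Function.Injective f ∧
      ∀ i x, lo + 1 ≤ D.lev (.inr (f i, x)) ∧ D.lev (.inr (f i, x)) ≤ hi - 1 := by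
  classical
  let S : Finset (Fin 7) := {i | ∃ x, D.lev (.inr (i, x)) = lo}
  let T : Finset (Fin 7) := {i | ∃ x, D.lev (.inr (i, x)) = hi}
  have hS : S.card ≤ 2 := card_touch_le_two D hG hM hlo S fun i hi => by simpa [S] using hi
  have hT : T.card ≤ 2 := by
    refine card_touch_le_two D.flip hG hM (lo := -hi) (fun v => ?_) T fun i hi => ?_
    · simpa [LevelDrawing.flip] using hhi v
    · simpa [T, LevelDrawing.flip] using hi
  have h : 3 ≤ (S ∪ T)ᶜ.card := by
    rw [Finset.card_compl, Fintype.card_fin]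
    have := Finset.card_union_le S T
    omega
  refine ⟨(S ∪ T)ᶜ.orderEmbOfCardLe h, ((S ∪ T)ᶜ.orderEmbOfCardLe h).injective, fun i x => ?_⟩
  have hmem := (S ∪ T)ᶜ.orderEmbOfCardLe_mem h i
  simp only [Finset.mem_compl, Finset.mem_union, not_or, S, T, Finset.mem_filter,
    Finset.mem_univ, true_and, not_exists] at hmem
  exact ⟨lt_of_le_of_ne (hlo _) fun he => hmem.1 x he.symm,
    Int.le_sub_one_of_lt (lt_of_le_of_ne (hhi _) (hmem.2 x))⟩

end polarGraph

namespace LevelDrawing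

variable {V : Type} {G : SimpleGraph V} (D : LevelDrawing G)

theorem false_of_three_on_level {v a b d : V} (ha : G.Adj v a) (hb : G.Adj v b) (hd : G.Adj v d)
    (hab : a ≠ b) (had : a ≠ d) (hbd : b ≠ d) (la : D.lev a = D.lev v) (lb : D.lev b = D.lev v)
    (ld : D.lev d = D.lev v) : False := by
  have hx : ∀ p q, p ≠ q → D.lev p = D.lev v → D.lev q = D.lev v → D.x p < D.x q ∨ D.x q < D.x p :=
    fun p q hpq hp hq => lt_or_gt_of_ne fun he => hpq (D.inj p q (hp.trans hq.symm) he)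
  have hr : ∀ p q, G.Adj v p → D.lev p = D.lev v → D.lev q = D.lev v →
      D.x v < D.x q → ¬ D.x q < D.x p := fun p q h hp hq =>
    D.no_vertex_between v p q h hp.symm (hq.trans hp.symm)
  have hl : ∀ p q, G.Adj v p → D.lev p = D.lev v → D.lev q = D.lev v →
      D.x p < D.x q → ¬ D.x q < D.x v := fun p q h hp hq =>
    D.no_vertex_between p v q h.symm hp hq
  have key : ∀ p q, G.Adj v p → G.Adj v q → p ≠ q → D.lev p = D.lev v → D.lev q = D.lev v →
      (D.x v < D.x p → ¬ D.x v < D.x q) ∧ (D.x p < D.x v → ¬ D.x q < D.x v) := by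
    intro p q hp hq hpq lp lq
    constructor
    · intro h1 h2
      rcases hx p q hpq lp lq with h | h
      · exact hr q p hq lq lp h1 h
      · exact hr p q hp lp lq h2 h
    · intro h1 h2
      rcases hx p q hpq lp lq with h | h
      · exact hl p q hp lp lq h h2
      · exact hl q p hq lq lp h h1
  have k1 := key a b ha hb hab la lb
  have k2 := key a d ha hd had la ld
  have k3 := key b d hb hd hbd lb ld
  rcases hx v a ha.ne rfl la with h1 | h1 <;> rcases hx v b hb.ne rfl lb with h2 | h2 <;>
    rcases hx v d hd.ne rfl ld with h3 | h3 <;> tauto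

theorem false_of_triangle_on_level {a b d : V} (hab : G.Adj a b) (had : G.Adj a d)
    (hbd : G.Adj b d) (lb : D.lev b = D.lev a) (ld : D.lev d = D.lev a) : False := by
  have hx : ∀ p q, p ≠ q → D.lev p = D.lev a → D.lev q = D.lev a → D.x p < D.x q ∨ D.x q < D.x p :=
    fun p q hpq hp hq => lt_or_gt_of_ne fun he => hpq (D.inj p q (hp.trans hq.symm) he)
  have hr : ∀ p q w, G.Adj p q → D.lev p = D.lev a → D.lev q = D.lev a → D.lev w = D.lev a →
      D.x p < D.x w → ¬ D.x w < D.x q := fun p q w h hp hq hw =>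
    D.no_vertex_between p q w h (hp.trans hq.symm) (hw.trans hq.symm)
  have k1 := hr a b d hab rfl lb ld
  have k2 := hr b a d hab.symm lb rfl ld
  have k3 := hr a d b had rfl ld lb
  have k4 := hr d a b had.symm ld rfl lb
  have k5 := hr b d a hbd lb ld rfl
  have k6 := hr d b a hbd.symm ld lb rfl
  rcases hx a b hab.ne rfl lb with h1 | h1 <;> rcases hx a d had.ne rfl ld with h2 | h2 <;>
    rcases hx b d hbd.ne lb ld with h3 | h3 <;> tauto

theorem false_of_middle_neighbour {B h a b d : V} {r : ℤ} (lB : D.lev B = r - 1)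
    (lh : D.lev h = r) (la : D.lev a = r + 1) (lb : D.lev b = r + 1) (ld : D.lev d = r + 1)
    (hB : G.Adj B b) (ha : G.Adj h a) (hd : G.Adj h d) (hab : D.x a < D.x b)
    (hbd : D.x b < D.x d) : False := by
  have e1 : D.c h a r = D.x h := by rw [← lh]; exact D.c_bot _ _ ha (by omega)
  have e2 : D.c h a (r + 1) = D.x a := by rw [← la]; exact D.c_top _ _ ha (by omega)
  have e3 : D.c h d r = D.x h := by rw [← lh]; exact D.c_bot _ _ hd (by omega)
  have e4 : D.c h d (r + 1) = D.x d := by rw [← ld]; exact D.c_top _ _ hd (by omega)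
  have e5 : D.c B b (r + 1) = D.x b := by rw [← lb]; exact D.c_top _ _ hB (by omega)
  have hne : D.c B b r ≠ D.x h := fun he => by
    rcases D.vertex_on B b h r hB (by omega) (by omega) (by omega) lh he with rfl | rfl <;> omega
  rcases lt_or_gt_of_ne hne with hlt | hlt
  · have := D.noncrossing B b h a r hB (by omega) (by omega) ha (by omega) (by omega)
      (by rwa [e1])
    linarith
  · have := D.noncrossing h d B b r hd (by omega) (by omega) hB (by omega) (by omega)
      (by rwa [e3])
    linarith

end LevelDrawing

/-- The vertices of the basic gadget. -/
inductive Gadget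
  | hub (s : Bool)
  | apex
  | leaf (s : Bool) (i : Fin 5)

namespace Gadget

instance : Finite Gadget :=
  Finite.of_surjective
    (fun | .inl s => hub s | .inr none => apex | .inr (some (s, i)) => leaf s i :
      Bool ⊕ Option (Bool × Fin 5) → Gadget) (by
    rintro (s | _ | ⟨s, i⟩)
    · exact ⟨.inl s, rfl⟩
    · exact ⟨.inr none, rfl⟩
    · exact ⟨.inr (some (s, i)), rfl⟩)

/-- Two adjacent hubs, each with five leaves, and an apex adjacent to both. -/
def graph : SimpleGraph Gadget where
  Adj
    | hub s, hub t => s ≠ t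
    | hub _, apex => True
    | apex, hub _ => True
    | hub s, leaf t _ => s = t
    | leaf t _, hub s => s = t
    | _, _ => False
  symm := ⟨by
    rintro (s | _ | ⟨s, i⟩) (t | _ | ⟨t, j⟩) h
    all_goals first | exact h | exact Ne.symm h⟩
  loopless := ⟨by
    rintro (s | _ | ⟨s, i⟩) h
    · exact h rfl
    · exact h
    · exact h⟩

/-- The apex has to be visible from above, the leaves from below. -/
def marks : Bool → Set Gadget
  | true => {apex}
  | false => {v | ∃ s i, v = leaf s i}

theorem marks_nonempty : ∀ s, (marks s).Nonempty
  | true => ⟨apex, rfl⟩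
  | false => ⟨leaf true 0, true, 0, rfl⟩

theorem connected : graph.Connected := by
  have h0 : ∀ s, graph.Adj apex (hub s) := fun s => trivial
  have h1 : ∀ s i, graph.Adj (hub s) (leaf s i) := fun s i => rfl
  have h : ∀ v, graph.Reachable apex v := by
    rintro (s | _ | ⟨s, i⟩)
    · exact (h0 s).reachable
    · rfl
    · exact (h0 s).reachable.trans (h1 s i).reachable
  have : Nonempty Gadget := ⟨apex⟩
  exact ⟨fun u v => (h u).symm.trans (h v)⟩

variable (D : LevelDrawing (polarGraph graph marks)) {r : ℤ} {i : Fin 7}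

theorem exists_three_leaves {s : Bool}
    (hl : ∀ x, D.lev (.inr (i, x)) = r ∨ D.lev (.inr (i, x)) = r + 1) {t : ℤ}
    (ht : t = r ∨ t = r + 1) (hs : D.lev (.inr (i, hub s)) = t) :
    ∃ a b d : Fin 5, D.lev (.inr (i, leaf s a)) = r + (r + 1) - t ∧
      D.lev (.inr (i, leaf s b)) = r + (r + 1) - t ∧
      D.lev (.inr (i, leaf s d)) = r + (r + 1) - t ∧
      D.x (.inr (i, leaf s a)) < D.x (.inr (i, leaf s b)) ∧
      D.x (.inr (i, leaf s b)) < D.x (.inr (i, leaf s d)) := by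
  classical
  let S : Finset (Fin 5) := {k | D.lev (.inr (i, leaf s k)) = t}
  have hS : S.card ≤ 2 := by
    by_contra! h
    obtain ⟨a, ha, b, hb, d, hd, hab, had, hbd⟩ := Finset.two_lt_card.mp h
    simp only [S, Finset.mem_filter, Finset.mem_univ, true_and] at ha hb hd
    refine D.false_of_three_on_level (v := .inr (i, hub s)) (a := .inr (i, leaf s a))
      (b := .inr (i, leaf s b)) (d := .inr (i, leaf s d)) ⟨rfl, rfl⟩ ⟨rfl, rfl⟩ ⟨rfl, rfl⟩
      (by simpa) (by simpa) (by simpa) (by rw [ha, hs]) (by rw [hb, hs]) (by rw [hd, hs])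
  have hc : 3 ≤ (Sᶜ.image fun k => D.x (.inr (i, leaf s k))).card := by
    rw [Finset.card_image_of_injOn, Finset.card_compl, Fintype.card_fin]
    · omega
    · intro a ha b hb hab
      simp only [S, Finset.coe_compl, Finset.coe_filter, Finset.mem_univ, true_and,
        Set.mem_compl_iff, Set.mem_ofPred_eq] at ha hb
      have := D.inj (.inr (i, leaf s a)) (.inr (i, leaf s b))
        (by have := hl (leaf s a); have := hl (leaf s b); omega) hab
      simpa using this
  let g := (Sᶜ.image fun k => D.x (.inr (i, leaf s k))).orderEmbOfCardLe hc
  have hg : ∀ j, ∃ k, D.lev (.inr (i, leaf s k)) = r + (r + 1) - t ∧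
      D.x (.inr (i, leaf s k)) = g j := by
    intro j
    have := (Sᶜ.image fun k => D.x (.inr (i, leaf s k))).orderEmbOfCardLe_mem hc j
    simp only [Finset.mem_image, S, Finset.mem_compl, Finset.mem_filter, Finset.mem_univ,
      true_and] at this
    obtain ⟨k, hk, hk'⟩ := this
    exact ⟨k, by have := hl (leaf s k); omega, hk'⟩
  obtain ⟨a, ha, ha'⟩ := hg 0
  obtain ⟨b, hb, hb'⟩ := hg 1
  obtain ⟨d, hd, hd'⟩ := hg 2
  refine ⟨a, b, d, ha, hb, hd, ?_, ?_⟩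
  · rw [ha', hb']
    exact g.strictMono (by decide)
  · rw [hb', hd']
    exact g.strictMono (by decide)

theorem false_of_two_rows_between_poles (h1 : D.lev (.inl true) = r + 2)
    (h2 : D.lev (.inl false) = r - 1)
    (hl : ∀ x, D.lev (.inr (i, x)) = r ∨ D.lev (.inr (i, x)) = r + 1) : False := by
  have hadj : ∀ s k, (polarGraph graph marks).Adj (.inr (i, hub s)) (.inr (i, leaf s k)) :=
    fun s k => ⟨rfl, rfl⟩
  have hhub : ∀ s, D.lev (.inr (i, hub s)) = r + 1 := by
    intro s
    refine (hl (hub s)).resolve_left fun hs => ?_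
    obtain ⟨a, b, d, ha, hb, hd, hab, hbd⟩ := exists_three_leaves D hl (.inl rfl) hs
    exact D.false_of_middle_neighbour (B := .inl false) (b := .inr (i, leaf s b)) h2 hs
      (by rw [ha]; ring) (by rw [hb]; ring)
      (by rw [hd]; ring) (show _ ∈ marks false from ⟨s, b, rfl⟩) (hadj s a) (hadj s d) hab hbd
  have hleaf : ∀ s, ∃ k, D.lev (.inr (i, leaf s k)) = r := by
    intro s
    obtain ⟨a, b, d, ha, -⟩ := exists_three_leaves D hl (.inr rfl) (hhub s)
    exact ⟨a, by rw [ha]; ring⟩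
  have hap : D.lev (.inr (i, apex)) = r := by
    refine (hl apex).resolve_right fun h => ?_
    exact D.false_of_triangle_on_level (a := .inr (i, apex)) (b := .inr (i, hub true))
      (d := .inr (i, hub false)) ⟨rfl, trivial⟩ ⟨rfl, trivial⟩ ⟨rfl, Bool.noConfusion⟩
      (by rw [h, hhub]) (by rw [h, hhub])
  have htop : (polarGraph graph marks).Adj (.inr (i, apex)) (.inl true) := rfl
  have hah : ∀ s, (polarGraph graph marks).Adj (.inr (i, apex)) (.inr (i, hub s)) :=
    fun s => ⟨rfl, trivial⟩
  have hhh : ∀ s t, s ≠ t → (polarGraph graph marks).Adj (.inr (i, hub s)) (.inr (i, hub t)) :=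
    fun s t h => ⟨rfl, h⟩
  have a0 : D.c (.inr (i, apex)) (.inl true) r = D.x (.inr (i, apex)) := by
    rw [← hap]; exact D.c_bot _ _ htop (by omega)
  have a1 : ∀ s, D.c (.inr (i, apex)) (.inr (i, hub s)) r = D.x (.inr (i, apex)) := by
    intro s; rw [← hap]; exact D.c_bot _ _ (hah s) (by rw [hhub]; omega)
  have a2 : ∀ s, D.c (.inr (i, apex)) (.inr (i, hub s)) (r + 1) = D.x (.inr (i, hub s)) := by
    intro s; rw [← hhub s]; exact D.c_top _ _ (hah s) (by rw [hhub]; omega)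
  have b1 : ∀ s k, D.lev (.inr (i, leaf s k)) = r →
      D.c (.inr (i, leaf s k)) (.inr (i, hub s)) r = D.x (.inr (i, leaf s k)) := by
    intro s k h; rw [← h]; exact D.c_bot _ _ (hadj s k).symm (by rw [hhub]; omega)
  have b2 : ∀ s k, D.lev (.inr (i, leaf s k)) = r →
      D.c (.inr (i, leaf s k)) (.inr (i, hub s)) (r + 1) = D.x (.inr (i, hub s)) := by
    intro s k h; rw [← hhub s]; exact D.c_top _ _ (hadj s k).symm (by rw [hhub]; omega)
  obtain ⟨s, t, hst, hx⟩ : ∃ s t, s ≠ t ∧ D.x (.inr (i, hub s)) < D.x (.inr (i, hub t)) := by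
    have : D.x (.inr (i, hub true)) ≠ D.x (.inr (i, hub false)) := fun h => by
      have := D.inj _ _ (by rw [hhub, hhub]) h
      simp at this
    rcases lt_or_gt_of_ne this with h | h
    · exact ⟨true, false, by decide, h⟩
    · exact ⟨false, true, by decide, h⟩
  have hne : ∀ s, D.c (.inr (i, apex)) (.inl true) (r + 1) ≠ D.x (.inr (i, hub s)) := by
    intro s h
    have := D.vertex_on _ _ _ _ htop (by omega) (by omega) (by omega) (hhub s) h
    simp at this
  have hnb := D.no_edge_between _ _ _ _ (r + 1) (hhh s t hst) (hhub s) (hhub t) htop (by omega)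
    (by omega) (by omega)
  rcases lt_or_gt_of_ne (hne s) with hlt | hlt
  · obtain ⟨k, hk⟩ := hleaf s
    have h3 : D.x (.inr (i, leaf s k)) ≤ D.x (.inr (i, apex)) := by
      by_contra! h
      have := D.noncrossing _ _ _ _ r (hah t) (by omega) (by rw [hhub]; omega) (hadj s k).symm
        (by omega) (by rw [hhub]; omega) (by rwa [a1, b1 s k hk])
      rw [a2, b2 s k hk] at this
      linarith
    have h4 : D.x (.inr (i, apex)) ≤ D.x (.inr (i, leaf s k)) := by
      by_contra! h
      have := D.noncrossing _ _ _ _ r (hadj s k).symm (by omega) (by rw [hhub]; omega) htop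
        (by omega) (by omega) (by rwa [a0, b1 s k hk])
      rw [b2 s k hk] at this
      linarith
    have := D.inj _ _ (by rw [hap, hk]) (le_antisymm h4 h3)
    simp at this
  · have hlt' : D.x (.inr (i, hub t)) < D.c (.inr (i, apex)) (.inl true) (r + 1) :=
      lt_of_le_of_ne (not_lt.mp (hnb hlt)) (hne t).symm
    obtain ⟨k, hk⟩ := hleaf t
    have h3 : D.x (.inr (i, apex)) ≤ D.x (.inr (i, leaf t k)) := by
      by_contra! h
      have := D.noncrossing _ _ _ _ r (hadj t k).symm (by omega) (by rw [hhub]; omega) (hah s)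
        (by omega) (by rw [hhub]; omega) (by rwa [a1, b1 t k hk])
      rw [a2, b2 t k hk] at this
      linarith
    have h4 : D.x (.inr (i, leaf t k)) ≤ D.x (.inr (i, apex)) := by
      by_contra! h
      have := D.noncrossing _ _ _ _ r htop (by omega) (by omega) (hadj t k).symm
        (by omega) (by rw [hhub]; omega) (by rwa [a0, b1 t k hk])
      rw [b2 t k hk] at this
      linarith
    have := D.inj _ _ (by rw [hap, hk]) (le_antisymm h3 h4)
    simp at this

theorem false_of_four_rows {lo : ℤ} (hlo : ∀ v, lo ≤ D.lev v) (hhi : ∀ v, D.lev v ≤ lo + 3) :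
    False := by
  obtain ⟨f, hf, hlev⟩ := polarGraph.exists_three_inner D connected marks_nonempty hlo hhi
  have hl : ∀ i x, D.lev (.inr (f i, x)) = lo + 1 ∨ D.lev (.inr (f i, x)) = lo + 1 + 1 := by
    intro i x
    have := hlev i x
    omega
  have htri : ∀ i t, ¬ ∀ x, D.lev (.inr (f i, x)) = t := fun i t h =>
    D.false_of_triangle_on_level (a := .inr (f i, apex)) (b := .inr (f i, hub true))
      (d := .inr (f i, hub false)) ⟨rfl, trivial⟩ ⟨rfl, trivial⟩ ⟨rfl, Bool.noConfusion⟩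
      (by rw [h, h]) (by rw [h, h])
  have hbot : ∀ i, ∃ x, D.lev (.inr (f i, x)) = lo + 1 := by
    intro i
    by_contra! h
    exact htri i _ fun x => (hl i x).resolve_left (h x)
  have htop : ∀ i, ∃ x, D.lev (.inr (f i, x)) = lo + 1 + 1 := by
    intro i
    by_contra! h
    exact htri i _ fun x => (hl i x).resolve_right (h x)
  have hpole : ∀ s, D.lev (.inl s) = lo ∨ D.lev (.inl s) = lo + 3 := by
    intro s
    by_contra! h
    have h1 := hlo (.inl s)
    have h2 := hhi (.inl s)
    exact polarGraph.false_of_three_span D connected marks_nonempty hf (lo := lo + 1)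
      (hi := lo + 1 + 1) (s := s) (by omega) (by omega) (fun i x => (hlev i x).1)
      (fun i x => by have := hl i x; omega) hbot htop
  have hne : D.lev (.inl true) ≠ D.lev (.inl false) := by
    intro he
    rcases hpole true with h | h
    · refine polarGraph.false_of_three_touch D.flip connected marks_nonempty hf
        (lo := -(lo + 1 + 1)) ?_ ?_ ?_
      · rintro (_ | _) <;> simp only [LevelDrawing.flip] <;> omega
      · intro i x
        have := hl i x
        simp only [LevelDrawing.flip]
        omega
      · simpa only [LevelDrawing.flip, neg_inj] using htop
    · refine polarGraph.false_of_three_touch D connected marks_nonempty hf (lo := lo + 1) ?_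
        (fun i x => (hlev i x).1) hbot
      rintro (_ | _) <;> omega
  rcases hpole true with h | h
  · refine false_of_two_rows_between_poles D.flip (r := -(lo + 1 + 1)) (i := f 0) ?_ ?_ ?_
    · simp only [LevelDrawing.flip]
      omega
    · have := hpole false
      simp only [LevelDrawing.flip]
      omega
    · intro x
      have := hl 0 x
      simp only [LevelDrawing.flip]
      omega
  · refine false_of_two_rows_between_poles D (r := lo + 1) (i := f 0) ?_ ?_ (hl 0)
    · omega
    · have := hpole false
      omega

end Gadget

/-- The marks of the doubled construction: each outer pole sees one inner pole of every copy. -/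
def poleMarks (X : Type) (s : Bool) : Set (Bool ⊕ Fin 7 × X) := {.inl s}

theorem false_of_six_rows
    (D : LevelDrawing (polarGraph (polarGraph Gadget.graph Gadget.marks) (poleMarks Gadget)))
    (h1 : ∀ v, 1 ≤ D.lev v) (h6 : ∀ v, D.lev v ≤ 6) : False := by
  obtain ⟨f, -, hf⟩ := polarGraph.exists_three_inner D
    (polarGraph.connected Gadget.connected Gadget.marks_nonempty) (fun s => ⟨.inl s, rfl⟩) h1 h6
  refine Gadget.false_of_four_rows
    (D.comap (polarGraph.copy (f 0)) (polarGraph.copy_injective (f 0))) (lo := 2)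
    (fun v => (hf 0 v).1) fun v => (hf 0 v).2

section Monotone

theorem chainSet_append (l m : List Pt) (p : Pt) :
    chainSet (l ++ p :: m) = chainSet (l ++ [p]) ∪ chainSet (p :: m) := by
  induction l with
  | nil =>
    cases m with
    | nil => simp [chainSet]
    | cons q m =>
      have : p ∈ segment ℝ p q := left_mem_segment ℝ p q
      simp [chainSet, this]
  | cons a l ih =>
    cases l with
    | nil =>
      cases m with
      | nil => simp [chainSet]
      | cons q m =>
        have : p ∈ segment ℝ a p := right_mem_segment ℝ a p
        simp [chainSet, this]
    | cons b l =>
      simp only [List.cons_append, chainSet] at ih ⊢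
      rw [ih, Set.union_assoc]

theorem chainSet_reverse (l : List Pt) : chainSet l.reverse = chainSet l := by
  induction l with
  | nil => rfl
  | cons p l ih =>
    cases l with
    | nil => rfl
    | cons q l =>
      have h : (p :: q :: l).reverse = l.reverse ++ q :: [p] := by simp
      have hp : p ∈ segment ℝ q p := right_mem_segment ℝ q p
      have h2 : chainSet [q, p] = segment ℝ p q := by
        rw [segment_symm ℝ p q]
        simp [chainSet, hp]
      rw [h, chainSet_append, h2, Set.union_comm, chainSet, ← ih]
      simp

/-- The properties of a `y`-monotone arc from `a` up to `b` with integer breakpoint ordinates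
that are used to extract its combinatorics. -/
structure IsMonotoneArc (S : Set Pt) (a b : Pt) : Prop where
  left_mem : a ∈ S
  right_mem : b ∈ S
  le : a.2 ≤ b.2
  slice : ∀ r : ℝ, (rowSlice S r).OrdConnected
  step : ∀ r : ℤ, a.2 ≤ r → (r + 1 : ℝ) ≤ b.2 →
    ∃ X Y : ℝ, segment ℝ (X, (r : ℝ)) (Y, (r + 1 : ℝ)) ⊆ S

theorem IsMonotoneArc.swap {S : Set Pt} {a b : Pt} (h : IsMonotoneArc S b a) (hab : a.2 ≤ b.2) :
    IsMonotoneArc S a b where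
  left_mem := h.right_mem
  right_mem := h.left_mem
  le := hab
  slice := h.slice
  step r h1 h2 := by
    have := h.le
    linarith

theorem exists_mem_segment_snd {p q : Pt} {t : ℝ} (h1 : p.2 ≤ t) (h2 : t ≤ q.2) :
    ∃ x : ℝ, (x, t) ∈ segment ℝ p q := by
  have h : t ∈ (LinearMap.snd ℝ ℝ ℝ).toAffineMap '' segment ℝ p q := by
    rw [image_segment]
    change t ∈ segment ℝ p.2 q.2
    rw [segment_eq_Icc (h1.trans h2)]
    exact ⟨h1, h2⟩
  obtain ⟨⟨x, y⟩, hxy, rfl⟩ := h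
  exact ⟨x, hxy⟩

theorem snd_le_of_mem_segment {p q z : Pt} (h : p.2 ≤ q.2) (hz : z ∈ segment ℝ p q) :
    p.2 ≤ z.2 ∧ z.2 ≤ q.2 := by
  have : z.2 ∈ (LinearMap.snd ℝ ℝ ℝ).toAffineMap '' segment ℝ p q := ⟨z, hz, rfl⟩
  rw [image_segment] at this
  simpa [segment_eq_Icc h] using this

theorem snd_le_of_mem_chainSet {l : List Pt} (hl : (l.map Prod.snd).IsChain (· ≤ ·)) {a : Pt}
    (ha : l.head? = some a) {z : Pt} (hz : z ∈ chainSet l) : a.2 ≤ z.2 := by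
  induction l generalizing a with
  | nil => simp at ha
  | cons p l ih =>
    obtain rfl : p = a := by simpa using ha
    cases l with
    | nil =>
      obtain rfl : z = p := by simpa [chainSet] using hz
      exact le_rfl
    | cons q l =>
      rw [List.map_cons, List.map_cons, List.isChain_cons_cons] at hl
      rcases hz with hz | hz
      · exact (snd_le_of_mem_segment hl.1 hz).1
      · exact hl.1.trans (ih hl.2 rfl hz)

theorem isMonotoneArc_chainSet {l : List Pt} (hl : (l.map Prod.snd).IsChain (· ≤ ·))
    (hbend : ∀ p ∈ l, ∃ k : ℤ, p.2 = k) {a b : Pt} (ha : l.head? = some a)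
    (hb : l.getLast? = some b) : IsMonotoneArc (chainSet l) a b := by
  induction l generalizing a with
  | nil => simp at ha
  | cons p l ih =>
    obtain rfl : p = a := by simpa using ha
    cases l with
    | nil =>
      obtain rfl : p = b := by simpa using hb
      refine ⟨rfl, rfl, le_rfl, fun r => ?_, fun r h1 h2 => by linarith⟩
      refine Set.ordConnected_of_Ioo fun x hx y hy hxy => ?_
      have hx : (x, r) = p := hx
      have hy : (y, r) = p := hy
      have := congrArg Prod.fst (hx.trans hy.symm)
      exact absurd this hxy.ne
    | cons q l =>
      rw [List.map_cons, List.map_cons, List.isChain_cons_cons] at hl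
      have h := ih hl.2 (fun z hz => hbend z (by simp [hz])) rfl (by simpa using hb)
      refine ⟨.inl (left_mem_segment ℝ p q), .inr h.right_mem, hl.1.trans h.le, fun r => ?_,
        fun r h1 h2 => ?_⟩
      · have hs : (rowSlice (segment ℝ p q) r).OrdConnected := by
          have : Convex ℝ (rowSlice (segment ℝ p q) r) := by
            have hc := (convex_segment (𝕜 := ℝ) p q)
            intro x hx y hy s t hs ht hst
            have := hc hx hy hs ht hst
            simpa [rowSlice, ← add_mul, hst] using this
          exact this.ordConnected
        have hu : rowSlice (chainSet (p :: q :: l)) r =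
          rowSlice (segment ℝ p q) r ∪ rowSlice (chainSet (q :: l)) r := rfl
        rw [hu]
        rcases lt_trichotomy r q.2 with hr | hr | hr
        · have : rowSlice (chainSet (q :: l)) r = ∅ := by
            refine Set.eq_empty_of_forall_notMem fun x hx => ?_
            have := snd_le_of_mem_chainSet (l := q :: l) hl.2 rfl hx
            exact absurd hr this.not_gt
          rwa [this, Set.union_empty]
        · rw [← isPreconnected_iff_ordConnected]
          refine IsPreconnected.union q.1 ?_ ?_ (isPreconnected_iff_ordConnected.mpr hs)
            (isPreconnected_iff_ordConnected.mpr (h.slice r))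
          · rw [hr]
            exact right_mem_segment ℝ p q
          · rw [hr]
            exact h.left_mem
        · have : rowSlice (segment ℝ p q) r = ∅ := by
            refine Set.eq_empty_of_forall_notMem fun x hx => ?_
            have := (snd_le_of_mem_segment hl.1 hx).2
            exact absurd hr this.not_gt
          rw [this, Set.empty_union]
          exact h.slice r
      · obtain ⟨k, hk⟩ := hbend q (by simp)
        by_cases hr : r + 1 ≤ k
        · have hr' : (r + 1 : ℝ) ≤ q.2 := by rw [hk]; exact_mod_cast hr
          obtain ⟨X, hX⟩ := exists_mem_segment_snd h1 (by linarith : (r : ℝ) ≤ q.2)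
          obtain ⟨Y, hY⟩ := exists_mem_segment_snd (by linarith : p.2 ≤ (r + 1 : ℝ)) hr'
          exact ⟨X, Y, ((convex_segment p q).segment_subset hX hY).trans Set.subset_union_left⟩
        · have hr' : q.2 ≤ r := by
            rw [hk]
            have : k ≤ r := by omega
            exact_mod_cast this
          obtain ⟨X, Y, hXY⟩ := h.step r hr' h2
          exact ⟨X, Y, hXY.trans Set.subset_union_right⟩

theorem mem_of_mem_chain {l : List Pt} {p : Pt} (hp : p ∈ l) :
    l.head? = some p ∨ p ∈ chainBends l ∨ l.getLast? = some p := by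
  cases l with
  | nil => simp at hp
  | cons q l =>
    rcases List.mem_cons.mp hp with rfl | hp
    · simp
    · right
      have hne : l ≠ [] := List.ne_nil_of_mem hp
      rw [← List.dropLast_append_getLast hne, List.mem_append, List.mem_singleton] at hp
      rcases hp with hp | hp
      · exact .inl hp
      · right
        rw [List.getLast?_cons, List.getLast?_eq_getLast_of_ne_nil hne, hp]
        rfl

theorem isMonotoneArc_edgePts {V : Type} {G : SimpleGraph V} (Γ : PolyDrawing G)
    (hm : Γ.IsYMonotone) (hbend : Γ.IntegerY) {u v : V} (h : G.Adj u v)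
    (hl : (Γ.pos u).2 ≤ (Γ.pos v).2) :
    IsMonotoneArc (Γ.edgePts s(u, v)) (Γ.pos u) (Γ.pos v) := by
  set l := Γ.arc s(u, v) with hl'
  have hk : ∀ p ∈ l, ∃ k : ℤ, p.2 = k := by
    intro p hp
    have hends := Γ.arc_ends u v h
    rw [← hl'] at hends
    rcases mem_of_mem_chain hp with hp | hp | hp
    · rcases hends with ⟨h1, -⟩ | ⟨h1, -⟩
      · rw [h1, Option.some_inj] at hp
        exact hp ▸ hbend.1 u
      · rw [h1, Option.some_inj] at hp
        exact hp ▸ hbend.1 v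
    · exact hbend.2 _ h p hp
    · rcases hends with ⟨-, h1⟩ | ⟨-, h1⟩
      · rw [h1, Option.some_inj] at hp
        exact hp ▸ hbend.1 v
      · rw [h1, Option.some_inj] at hp
        exact hp ▸ hbend.1 u
  have hS : Γ.edgePts s(u, v) = chainSet l := rfl
  rcases hm s(u, v) h with hc | hc
  · rcases Γ.arc_ends u v h with ⟨h1, h2⟩ | ⟨h1, h2⟩
    · exact isMonotoneArc_chainSet hc hk h1 h2
    · exact (isMonotoneArc_chainSet hc hk h1 h2).swap hl
  · have hc' : (l.reverse.map Prod.snd).IsChain (· ≤ ·) := by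
      rw [List.map_reverse, List.isChain_reverse]
      exact hc
    rw [hS, ← chainSet_reverse]
    have hk' : ∀ p ∈ l.reverse, ∃ k : ℤ, p.2 = k := fun p hp => hk p (List.mem_reverse.mp hp)
    rcases Γ.arc_ends u v h with ⟨h1, h2⟩ | ⟨h1, h2⟩
    · exact (isMonotoneArc_chainSet hc' hk' (by rw [List.head?_reverse]; exact h2)
        (by rw [List.getLast?_reverse]; exact h1)).swap hl
    · exact isMonotoneArc_chainSet hc' hk' (by rw [List.head?_reverse]; exact h2)
        (by rw [List.getLast?_reverse]; exact h1)

end Monotone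

namespace PolyDrawing

variable {V : Type} {G : SimpleGraph V} (Γ : PolyDrawing G)

theorem exists_mem_both {S T : Set Pt} {r a b X X' : ℝ} (hS : (rowSlice S r).OrdConnected)
    (hT : (rowSlice T r).OrdConnected) (ha : a ∈ rowSlice S r) (hb : b ∈ rowSlice T r)
    (hX : X ∈ rowSlice S r) (hX' : X' ∈ rowSlice T r) (hab : a < b) (hXX' : X' ≤ X) :
    ∃ t, (t, r) ∈ S ∩ T := by
  refine ⟨max (min a X) (min b X'), hS.uIcc_subset ha hX ?_, hT.uIcc_subset hb hX' ?_⟩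
  · refine ⟨le_max_left _ _, max_le (min_le_of_left_le (le_max_left _ _)) ?_⟩
    exact (min_le_right _ _).trans (hXX'.trans (le_max_right _ _))
  · refine ⟨le_max_right _ _, max_le ?_ (min_le_of_left_le (le_max_left _ _))⟩
    exact (min_le_left _ _).trans (hab.le.trans (le_max_left _ _))

theorem exists_mem_segments {X Y X' Y' r : ℝ} (h1 : X < X') (h2 : Y' < Y) :
    ∃ t s : ℝ, 0 < s ∧ s < 1 ∧
      (t, r + s) ∈ segment ℝ (X, r) (Y, r + 1) ∩ segment ℝ (X', r) (Y', r + 1) := by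
  have hd : 0 < (X' - X) + (Y - Y') := by linarith
  set s := (X' - X) / ((X' - X) + (Y - Y')) with hs
  have hs' : s * ((X' - X) + (Y - Y')) = X' - X := div_mul_cancel₀ _ hd.ne'
  have hs0 : 0 < s := div_pos (by linarith) hd
  have hs1 : s < 1 := by
    rw [hs, div_lt_one hd]
    linarith
  refine ⟨(1 - s) * X + s * Y, s, hs0, hs1, ⟨1 - s, s, by linarith, hs0.le, by ring, ?_⟩,
    ⟨1 - s, s, by linarith, hs0.le, by ring, ?_⟩⟩
  · ext
    · simp
    · simp; ring
  · ext
    · simp; linarith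
    · simp; ring

/-- The level drawing underlying a planar `y`-monotone drawing with integer ordinates. -/
noncomputable def toLevelDrawing (hp : Γ.IsPlanar) (lev : V → ℤ)
    (hlev : ∀ v, (Γ.pos v).2 = lev v)
    (harc : ∀ u v, G.Adj u v → (Γ.pos u).2 ≤ (Γ.pos v).2 →
      IsMonotoneArc (Γ.edgePts s(u, v)) (Γ.pos u) (Γ.pos v)) : LevelDrawing G :=
  let x : V → ℝ := fun v => (Γ.pos v).1
  let c : V → V → ℤ → ℝ := fun u v r => if r = lev u then x u else if r = lev v then x v else
    Classical.epsilon fun t => (t, (r : ℝ)) ∈ Γ.edgePts s(u, v)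
  have hpos : ∀ v, Γ.pos v = (x v, (lev v : ℝ)) := fun v => Prod.ext rfl (hlev v)
  have arc : ∀ u v, G.Adj u v → lev u ≤ lev v →
      IsMonotoneArc (Γ.edgePts s(u, v)) (Γ.pos u) (Γ.pos v) := fun u v h hl =>
    harc u v h (by rw [hlev, hlev]; exact_mod_cast hl)
  have c_bot : ∀ u v, c u v (lev u) = x u := fun u v => if_pos rfl
  have c_top : ∀ u v, lev u < lev v → c u v (lev v) = x v := fun u v h => by
    simp only [c, if_neg h.ne', if_true]
  have c_mem : ∀ u v r, G.Adj u v → lev u < lev v → lev u ≤ r → r ≤ lev v →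
      (c u v r, (r : ℝ)) ∈ Γ.edgePts s(u, v) := by
    intro u v r h hl h1 h2
    have ha := arc u v h hl.le
    rcases h1.eq_or_lt with rfl | h1
    · rw [c_bot, ← hpos]
      exact ha.left_mem
    rcases h2.eq_or_lt with rfl | h2
    · rw [c_top u v hl, ← hpos]
      exact ha.right_mem
    simp only [c, if_neg h1.ne', if_neg h2.ne]
    obtain ⟨X, Y, hXY⟩ := ha.step r (by rw [hlev]; exact_mod_cast h1.le)
      (by rw [hlev]; exact_mod_cast h2)
    exact Classical.epsilon_spec (p := fun t => (t, (r : ℝ)) ∈ Γ.edgePts s(u, v))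
      ⟨X, hXY (left_mem_segment ℝ _ _)⟩
  have vmem : ∀ u v w, G.Adj u v → Γ.pos w ∈ Γ.edgePts s(u, v) → w = u ∨ w = v := by
    intro u v w h hw
    by_contra hcon
    exact hp.1 w s(u, v) h (by simpa using hcon) hw
  have emem : ∀ u v p q z, G.Adj u v → G.Adj p q → z ∈ Γ.edgePts s(u, v) →
      z ∈ Γ.edgePts s(p, q) → s(u, v) = s(p, q) ∨
        ∃ w, (w = u ∨ w = v) ∧ (w = p ∨ w = q) ∧ z = Γ.pos w := by
    intro u v p q z h h' hz hz'
    by_cases he : s(u, v) = s(p, q)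
    · exact .inl he
    · obtain ⟨w, h1, h2, h3⟩ := hp.2 _ h _ h' he z ⟨hz, hz'⟩
      exact .inr ⟨w, by simpa using h1, by simpa using h2, h3⟩
  { lev := lev
    x := x
    c := c
    inj := fun u v h1 h2 => Γ.pos_inj (by rw [hpos, hpos, h1, h2])
    c_bot := fun u v _ _ => c_bot u v
    c_top := fun u v _ h => c_top u v h
    vertex_on := by
      intro u v w r h hl h1 h2 hw hc
      refine vmem u v w h ?_
      rw [hpos, ← hc, hw]
      exact c_mem u v r h hl h1 h2
    edge_on := by
      intro u v p q r h hl h1 h2 h' hl' h1' h2' hc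
      rcases emem u v p q _ h h' (c_mem u v r h hl h1 h2)
        (by rw [hc]; exact c_mem p q r h' hl' h1' h2') with he | ⟨w, hw, hw', -⟩
      · rw [Sym2.eq_iff] at he
        tauto
      · grind
    noncrossing := by
      intro u v p q r h h1 h2 h' h1' h2' hc
      by_contra! hc'
      have hl : lev u < lev v := by omega
      have hl' : lev p < lev q := by omega
      have ha := arc u v h hl.le
      have ha' := arc p q h' hl'.le
      have common : ∀ z, z ∈ Γ.edgePts s(u, v) → z ∈ Γ.edgePts s(p, q) →
          ∃ w, (w = u ∨ w = v) ∧ (w = p ∨ w = q) ∧ z = Γ.pos w := by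
        intro z hz hz'
        refine (emem u v p q z h h' hz hz').resolve_left fun he => ?_
        rw [Sym2.eq_iff] at he
        rcases he with ⟨rfl, rfl⟩ | ⟨rfl, rfl⟩
        · exact lt_irrefl _ hc
        · omega
      obtain ⟨X, Y, hXY⟩ := ha.step r (by rw [hlev]; exact_mod_cast h1)
        (by rw [hlev]; exact_mod_cast h2)
      obtain ⟨X', Y', hXY'⟩ := ha'.step r (by rw [hlev]; exact_mod_cast h1')
        (by rw [hlev]; exact_mod_cast h2')
      have hX : X < X' := by
        by_contra! hcon
        obtain ⟨t, ht, ht'⟩ := exists_mem_both (ha.slice r) (ha'.slice r)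
          (c_mem u v r h hl h1 h2.le) (c_mem p q r h' hl' h1' h2'.le)
          (hXY (left_mem_segment ℝ _ _)) (hXY' (left_mem_segment ℝ _ _)) hc hcon
        obtain ⟨w, hw, hw', hz⟩ := common _ ht ht'
        have hr : lev w = r := by
          have : (r : ℝ) = (Γ.pos w).2 := congrArg Prod.snd hz
          rw [hlev] at this
          exact_mod_cast this.symm
        have e1 : w = u := hw.resolve_right (by rintro rfl; omega)
        have e2 : w = p := hw'.resolve_right (by rintro rfl; omega)
        have k1 := c_bot u v
        have k2 := c_bot p q
        rw [← e1, hr] at k1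
        rw [← e2, hr] at k2
        rw [← e1, ← e2] at hc
        linarith
      have hY : Y' < Y := by
        by_contra! hcon
        have hm := c_mem u v (r + 1) h hl (by omega) h2
        have hm' := c_mem p q (r + 1) h' hl' (by omega) h2'
        push_cast at hm hm'
        obtain ⟨t, ht', ht⟩ := exists_mem_both (ha'.slice (r + 1)) (ha.slice (r + 1)) hm' hm
          (hXY' (right_mem_segment ℝ _ _)) (hXY (right_mem_segment ℝ _ _)) hc' hcon
        obtain ⟨w, hw, hw', hz⟩ := common _ ht ht'
        have hr : lev w = r + 1 := by
          have : (r + 1 : ℝ) = (Γ.pos w).2 := congrArg Prod.snd hz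
          rw [hlev] at this
          exact_mod_cast this.symm
        have e1 : w = v := hw.resolve_left (by rintro rfl; omega)
        have e2 : w = q := hw'.resolve_left (by rintro rfl; omega)
        have k1 := c_top u v hl
        have k2 := c_top p q hl'
        rw [← e1, hr] at k1
        rw [← e2, hr] at k2
        rw [← e1, ← e2] at hc'
        linarith
      obtain ⟨t, s, hs0, hs1, ht, ht'⟩ := exists_mem_segments (r := (r : ℝ)) hX hY
      obtain ⟨w, -, -, hz⟩ := common _ (hXY ht) (hXY' ht')
      have hr : (lev w : ℝ) = r + s := by
        have := congrArg Prod.snd hz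
        rw [hlev] at this
        exact this.symm
      have k1 : r < lev w := by
        have : (r : ℝ) < lev w := by linarith
        exact_mod_cast this
      have k2 : lev w < r + 1 := by
        have : (lev w : ℝ) < r + 1 := by linarith
        exact_mod_cast this
      omega
    no_vertex_between := by
      intro u v w h hl hw h1 h2
      have ha := arc u v h hl.le
      have hu := ha.left_mem
      have hv := ha.right_mem
      rw [hpos] at hu hv
      rw [hl] at hu
      have : Γ.pos w ∈ Γ.edgePts s(u, v) := by
        rw [hpos, hw]
        exact (ha.slice (lev v)).out hu hv ⟨h1.le, h2.le⟩
      rcases vmem u v w h this with rfl | rfl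
      · exact lt_irrefl _ h1
      · exact lt_irrefl _ h2
    no_edge_between := by
      intro u v p q r h hu hv h' hl h1 h2 h3 h4
      have ha := arc u v h (by omega)
      have hmu := ha.left_mem
      have hmv := ha.right_mem
      rw [hpos, hu] at hmu
      rw [hpos, hv] at hmv
      have hm := (ha.slice r).out hmu hmv ⟨h3.le, h4.le⟩
      rcases emem u v p q _ h h' hm (c_mem p q r h' hl h1 h2) with he | ⟨w, hw, -, hz⟩
      · rw [Sym2.eq_iff] at he
        rcases he with ⟨rfl, rfl⟩ | ⟨rfl, rfl⟩ <;> omega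
      · have : c p q r = x w := congrArg Prod.fst hz
        rcases hw with rfl | rfl <;> linarith }

theorem exists_levelDrawing (hp : Γ.IsPlanar) (hm : Γ.IsYMonotone) {n : ℕ}
    (hn : Γ.HasHeight n) : ∃ D : LevelDrawing G, ∀ v, 1 ≤ D.lev v ∧ D.lev v ≤ n := by
  choose lev h1 h2 hlev using hn.1
  have hbend : Γ.IntegerY := ⟨fun v => ⟨lev v, hlev v⟩, fun e he p hpe => by
    obtain ⟨k, -, -, hk⟩ := hn.2 e he p hpe
    exact ⟨k, hk⟩⟩
  exact ⟨Γ.toLevelDrawing hp lev hlev fun u v h hl => isMonotoneArc_edgePts Γ hm hbend h hl,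
    fun v => ⟨h1 v, h2 v⟩⟩

end PolyDrawing

/-- `S` is a polygonal simple arc between `a` and `b` whose bends are on the rows `1, …, h`. -/
def IsEdgeCurve (h : ℕ) (a b : Pt) (S : Set Pt) : Prop :=
  IsSimpleArc S a b ∧ ∃ l : List Pt, chainSet l = S ∧ l.head? = some a ∧ l.getLast? = some b ∧
    ∀ p ∈ chainBends l, ∃ k : ℤ, 1 ≤ k ∧ k ≤ (h : ℤ) ∧ p.2 = (k : ℝ)

theorem IsSimpleArc.symm {S : Set Pt} {a b : Pt} (h : IsSimpleArc S a b) : IsSimpleArc S b a := by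
  obtain ⟨γ, hc, hi, hS, h0, h1⟩ := h
  have hm : Set.MapsTo (fun t : ℝ => 1 - t) (Set.Icc 0 1) (Set.Icc 0 1) := fun t ht =>
    ⟨by linarith [ht.2], by linarith [ht.1]⟩
  refine ⟨fun t => γ (1 - t), hc.comp (by fun_prop) hm, ?_, ?_, by simpa using h1,
    by simpa using h0⟩
  · intro t ht t' ht' he
    have := hi (hm ht) (hm ht') he
    linarith
  · rw [← hS]
    ext z
    constructor
    · rintro ⟨t, ht, rfl⟩
      exact ⟨1 - t, hm ht, rfl⟩
    · rintro ⟨t, ht, rfl⟩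
      exact ⟨1 - t, hm ht, by simp⟩

theorem isEdgeCurve_segment (h : ℕ) {a b : Pt} (hab : a ≠ b) :
    IsEdgeCurve h a b (segment ℝ a b) := by
  refine ⟨⟨AffineMap.lineMap a b, ?_, ?_, (segment_eq_image_lineMap ℝ a b).symm,
    AffineMap.lineMap_apply_zero a b, AffineMap.lineMap_apply_one a b⟩, [a, b], ?_, rfl, rfl, ?_⟩
  · exact AffineMap.lineMap_continuous.continuousOn
  · exact (AffineMap.lineMap_injective ℝ hab).injOn
  · have : b ∈ segment ℝ a b := right_mem_segment ℝ a b
    simp [chainSet, this]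
  · simp [chainBends]

theorem chainSet_map_add (l : List Pt) (c : Pt) :
    chainSet (l.map (· + c)) = (· + c) '' chainSet l := by
  induction l with
  | nil => simp [chainSet]
  | cons p l ih =>
    cases l with
    | nil => simp [chainSet]
    | cons q l =>
      have hs : segment ℝ (p + c) (q + c) = (· + c) '' segment ℝ p q := by
        have := segment_translate_image ℝ c p q
        simpa only [add_comm] using this.symm
      simp only [List.map_cons, chainSet] at ih ⊢
      rw [ih, hs, Set.image_union]

theorem IsEdgeCurve.translate {h : ℕ} {a b : Pt} {S : Set Pt} (hS : IsEdgeCurve h a b S) (c : ℝ) :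
    IsEdgeCurve (h + 2) (a + (c, 1)) (b + (c, 1)) ((· + (c, 1)) '' S) := by
  obtain ⟨⟨γ, hc, hi, hS, h0, h1⟩, l, hl, ha, hb, hk⟩ := hS
  refine ⟨⟨fun t => γ t + (c, 1), hc.add continuousOn_const, ?_, ?_, by simp [h0], by simp [h1]⟩,
    l.map (· + (c, 1)), ?_, by simp [ha], by simp [hb], ?_⟩
  · intro t ht t' ht' he
    exact hi ht ht' (add_right_cancel he)
  · rw [← hS, Set.image_image]
  · rw [chainSet_map_add, hl]
  · intro p hp
    have : chainBends (l.map (· + (c, 1))) = (chainBends l).map (· + (c, 1)) := by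
      simp [chainBends, List.map_dropLast]
    rw [this, List.mem_map] at hp
    obtain ⟨q, hq, rfl⟩ := hp
    obtain ⟨k, h1, h2, h3⟩ := hk q hq
    exact ⟨k + 1, by omega, by push_cast; omega, by simp [h3]⟩

/-- A planar poly-line drawing in a box, with an orientation `R` of the edges, in which the
vertices of `M true` and `M false` lie on the top and on the bottom row. -/
structure Sketch {V : Type} (G : SimpleGraph V) (M : Bool → Set V) (h : ℕ) (W : ℝ) where
  R : V → V → Prop
  pos : V → Pt
  E : V → V → Set Pt
  adj : ∀ u v, G.Adj u v → R u v ∨ R v u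
  inj : Function.Injective pos
  curve : ∀ u v, R u v → IsEdgeCurve h (pos u) (pos v) (E u v)
  vertex : ∀ u v w, R u v → pos w ∈ E u v → w = u ∨ w = v
  edge : ∀ u v p q, R u v → R p q → ∀ z, z ∈ E u v → z ∈ E p q →
    (u = p ∧ v = q) ∨ ∃ w, (w = u ∨ w = v) ∧ (w = p ∨ w = q) ∧ z = pos w
  row : ∀ v, ∃ k : ℤ, 1 ≤ k ∧ k ≤ (h : ℤ) ∧ (pos v).2 = k
  width : ∀ v, |(pos v).1| < W
  box : ∀ u v, R u v → ∀ z ∈ E u v, |z.1| < W ∧ 1 ≤ z.2 ∧ z.2 ≤ h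
  top : ∀ v ∈ M true, (pos v).2 = h
  bottom : ∀ v ∈ M false, (pos v).2 = 1

namespace Sketch

variable {V : Type} {G : SimpleGraph V} {M : Bool → Set V} {h : ℕ} {W : ℝ}

theorem exists_polyDrawing (K : Sketch G M h W) :
    ∃ Γ : PolyDrawing G, Γ.IsPlanar ∧ Γ.HasHeight h := by
  have key : ∀ e : Sym2 V, ∃ (u v : V) (l : List Pt), e ∈ G.edgeSet → e = s(u, v) ∧ K.R u v ∧
      chainSet l = K.E u v ∧ l.head? = some (K.pos u) ∧ l.getLast? = some (K.pos v) ∧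
      ∀ p ∈ chainBends l, ∃ k : ℤ, 1 ≤ k ∧ k ≤ (h : ℤ) ∧ p.2 = (k : ℝ) := by
    intro e
    induction e using Sym2.ind with
    | _ u v =>
      by_cases he : s(u, v) ∈ G.edgeSet
      · rcases K.adj u v he with hR | hR
        · obtain ⟨-, l, hl⟩ := K.curve _ _ hR
          exact ⟨u, v, l, fun _ => ⟨rfl, hR, hl⟩⟩
        · obtain ⟨-, l, hl⟩ := K.curve _ _ hR
          exact ⟨v, u, l, fun _ => ⟨Sym2.eq_swap, hR, hl⟩⟩
      · exact ⟨u, v, [], fun h => absurd h he⟩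
  choose a b l hl using key
  let Γ : PolyDrawing G :=
    { pos := K.pos
      pos_inj := K.inj
      arc := l
      arc_ends := by
        intro u v huv
        obtain ⟨he, -, -, h1, h2, -⟩ := hl s(u, v) huv
        rcases Sym2.eq_iff.mp he with ⟨h3, h4⟩ | ⟨h3, h4⟩
        · rw [← h3] at h1
          rw [← h4] at h2
          exact .inl ⟨h1, h2⟩
        · rw [← h4] at h1
          rw [← h3] at h2
          exact .inr ⟨h1, h2⟩
      arc_simple := by
        intro u v huv
        obtain ⟨he, hR, hS, -⟩ := hl s(u, v) huv
        have hc := (K.curve _ _ hR).1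
        rw [← hS] at hc
        rcases Sym2.eq_iff.mp he with ⟨h3, h4⟩ | ⟨h3, h4⟩
        · rw [← h3, ← h4] at hc
          exact hc
        · rw [← h3, ← h4] at hc
          exact hc.symm }
  have hE : ∀ e ∈ G.edgeSet, Γ.edgePts e = K.E (a e) (b e) := fun e he => (hl e he).2.2.1
  refine ⟨Γ, ⟨fun v e he hv hmem => ?_, fun e he f hf hef p hp => ?_⟩, K.row, fun e he =>
    (hl e he).2.2.2.2.2⟩
  · rw [hE e he] at hmem
    rw [(hl e he).1, Sym2.mem_iff] at hv
    exact hv (K.vertex _ _ _ (hl e he).2.1 hmem)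
  · rw [hE e he, hE f hf] at hp
    rcases K.edge _ _ _ _ (hl e he).2.1 (hl f hf).2.1 p hp.1 hp.2 with ⟨h1, h2⟩ | ⟨w, h1, h2, h3⟩
    · exact absurd (by rw [(hl e he).1, (hl f hf).1, h1, h2]) hef
    · refine ⟨w, ?_, ?_, h3⟩
      · rw [(hl e he).1, Sym2.mem_iff]
        exact h1
      · rw [(hl f hf).1, Sym2.mem_iff]
        exact h2

end Sketch

theorem mem_segment_iff_exists {a b z : Pt} : z ∈ segment ℝ a b ↔
    ∃ t : ℝ, 0 ≤ t ∧ t ≤ 1 ∧ z = (a.1 + t * (b.1 - a.1), a.2 + t * (b.2 - a.2)) := by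
  rw [segment_eq_image']
  constructor
  · rintro ⟨t, ⟨h0, h1⟩, rfl⟩
    exact ⟨t, h0, h1, rfl⟩
  · rintro ⟨t, h0, h1, rfl⟩
    exact ⟨t, ⟨h0, h1⟩, rfl⟩

namespace Gadget

/-- The sign of a side of the gadget. -/
def sign (s : Bool) : ℝ := if s then 1 else -1

theorem isEdgeCurve_hubs :
    IsEdgeCurve 2 (1, 2) (-1, 2) {z | z.2 = 1 + |z.1| ∧ |z.1| ≤ 1} := by
  refine ⟨⟨fun t => (1 - 2 * t, 1 + |1 - 2 * t|), ?_, ?_, ?_, ?_, ?_⟩,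
    [(1, 2), (0, 1), (-1, 2)], ?_, rfl, rfl, ?_⟩
  · fun_prop
  · intro t _ t' _ he
    have := congrArg Prod.fst he
    simp only at this
    linarith
  · ext ⟨x, y⟩
    simp only [Set.mem_image, Set.mem_Icc, Prod.mk.injEq, Set.mem_ofPred_eq, abs_le]
    constructor
    · rintro ⟨t, ⟨h0, h1⟩, rfl, rfl⟩
      exact ⟨rfl, by linarith, by linarith⟩
    · rintro ⟨rfl, h1, h2⟩
      refine ⟨(1 - x) / 2, ⟨by linarith, by linarith⟩, by ring, ?_⟩
      congr 2
      ring
  · norm_num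
  · norm_num
  · ext ⟨x, y⟩
    have h0 : ((-1, 2) : Pt) ∈ segment ℝ ((0, 1) : Pt) (-1, 2) := right_mem_segment ℝ _ _
    simp only [chainSet, Set.mem_union, Set.mem_singleton_iff, mem_segment_iff_exists,
      Set.mem_ofPred_eq, Prod.mk.injEq, abs_le]
    constructor
    · rintro (⟨t, h0, h1, rfl, rfl⟩ | ⟨t, h0, h1, rfl, rfl⟩ | ⟨rfl, rfl⟩)
      · rw [abs_of_nonneg (by linarith)]
        exact ⟨by ring, by linarith, by linarith⟩
      · rw [abs_of_nonpos (by linarith)]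
        exact ⟨by ring, by linarith, by linarith⟩
      · norm_num
    · rintro ⟨rfl, h1, h2⟩
      rcases le_total 0 x with hx | hx
      · rw [abs_of_nonneg hx]
        exact .inl ⟨1 - x, by linarith, by linarith, by ring, by ring⟩
      · rw [abs_of_nonpos hx]
        exact .inr (.inl ⟨-x, by linarith, by linarith, by ring, by ring⟩)
  · simp only [chainBends, List.drop_succ_cons, List.drop_zero, List.dropLast_cons_cons,
      List.dropLast_singleton, List.mem_singleton, forall_eq]
    exact ⟨1, by norm_num, by norm_num, by norm_num⟩

/-- The positions of the vertices of the gadget. -/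
noncomputable def pos : Gadget → Pt
  | hub s => (sign s, 2)
  | apex => (0, 2)
  | leaf s i => (sign s * (1 + (i : ℕ)), 1)

/-- An orientation of the edges of the gadget. -/
def orient : Gadget → Gadget → Prop
  | hub s, hub t => s = true ∧ t = false
  | hub _, apex => True
  | hub s, leaf t _ => s = t
  | _, _ => False

/-- The curves of the edges of the gadget. -/
def curve : Gadget → Gadget → Set Pt
  | hub _, hub _ => {z | z.2 = 1 + |z.1| ∧ |z.1| ≤ 1}
  | u, v => segment ℝ (pos u) (pos v)

theorem sign_cases (s : Bool) : (s = true ∧ sign s = 1) ∨ (s = false ∧ sign s = -1) := by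
  cases s <;> simp [sign]

theorem mem_curve_apex {s : Bool} {z : Pt} : z ∈ curve (hub s) apex ↔
    ∃ t : ℝ, 0 ≤ t ∧ t ≤ 1 ∧ z = (sign s * (1 - t), 2) := by
  simp only [curve, mem_segment_iff_exists, pos]
  refine exists_congr fun t => and_congr_right fun _ => and_congr_right fun _ => ?_
  ring_nf

theorem mem_curve_leaf {s t : Bool} {i : Fin 5} (hst : s = t) {z : Pt} :
    z ∈ curve (hub s) (leaf t i) ↔
    ∃ r : ℝ, 0 ≤ r ∧ r ≤ 1 ∧ z = (sign s * (1 + r * (i : ℕ)), 2 - r) := by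
  subst hst
  simp only [curve, mem_segment_iff_exists, pos]
  refine exists_congr fun t => and_congr_right fun _ => and_congr_right fun _ => ?_
  ring_nf

theorem abs_sign_mul (s : Bool) (x : ℝ) : |sign s * x| = |x| := by
  rcases sign_cases s with ⟨-, h⟩ | ⟨-, h⟩ <;> simp [h]

theorem pos_injective : Function.Injective pos := by
  rintro (s | _ | ⟨s, i⟩) (t | _ | ⟨t, j⟩) h <;> simp only [pos, Prod.mk.injEq] at h
  · rcases sign_cases s with ⟨rfl, e⟩ | ⟨rfl, e⟩ <;>
      rcases sign_cases t with ⟨rfl, e'⟩ | ⟨rfl, e'⟩ <;>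
      first | rfl | (rw [e, e'] at h; norm_num at h)
  · rcases sign_cases s with ⟨rfl, e⟩ | ⟨rfl, e⟩ <;> rw [e] at h <;> norm_num at h
  · norm_num at h
  · rcases sign_cases t with ⟨rfl, e⟩ | ⟨rfl, e⟩ <;> rw [e] at h <;> norm_num at h
  · rfl
  · norm_num at h
  · norm_num at h
  · norm_num at h
  · have hi : (0 : ℝ) ≤ (i : ℕ) := Nat.cast_nonneg _
    have hj : (0 : ℝ) ≤ (j : ℕ) := Nat.cast_nonneg _
    have key : s = t ∧ ((i : ℕ) : ℝ) = (j : ℕ) := by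
      rcases sign_cases s with ⟨rfl, e⟩ | ⟨rfl, e⟩ <;>
        rcases sign_cases t with ⟨rfl, e'⟩ | ⟨rfl, e'⟩ <;> simp only [e, e'] at h
      · exact ⟨rfl, by linarith [h.1]⟩
      · linarith [h.1]
      · linarith [h.1]
      · exact ⟨rfl, by linarith [h.1]⟩
    rw [key.1, Fin.ext (Nat.cast_injective key.2)]

theorem isEdgeCurve_curve (u v : Gadget) (h : orient u v) :
    IsEdgeCurve 2 (pos u) (pos v) (curve u v) := by
  rcases u with s | _ | ⟨s, i⟩ <;> rcases v with t | _ | ⟨t, j⟩ <;> try exact h.elim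
  · obtain ⟨rfl, rfl⟩ := h
    exact isEdgeCurve_hubs
  · exact isEdgeCurve_segment 2 (pos_injective.ne (by simp))
  · exact isEdgeCurve_segment 2 (pos_injective.ne (by simp))

theorem mem_box (u v : Gadget) (h : orient u v) (z : Pt) (hz : z ∈ curve u v) :
    |z.1| < 7 ∧ 1 ≤ z.2 ∧ z.2 ≤ 2 := by
  rcases u with s | _ | ⟨s, i⟩ <;> rcases v with t | _ | ⟨t, j⟩ <;> try exact h.elim
  · obtain ⟨h1, h2⟩ := hz
    have := abs_nonneg z.1
    exact ⟨by linarith, by linarith, by linarith⟩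
  · obtain ⟨t, h0, h1, rfl⟩ := mem_curve_apex.mp hz
    rw [abs_sign_mul, abs_of_nonneg (by linarith)]
    exact ⟨by linarith, by norm_num, le_rfl⟩
  · obtain ⟨r, h0, h1, rfl⟩ := (mem_curve_leaf h).mp hz
    have hj : (0 : ℝ) ≤ (j : ℕ) := Nat.cast_nonneg _
    have hj' : ((j : ℕ) : ℝ) ≤ 4 := by
      have : (j : ℕ) ≤ 4 := by omega
      exact_mod_cast this
    have hm := mul_nonneg h0 hj
    have hm' := mul_le_mul h1 hj' hj zero_le_one
    rw [abs_sign_mul, abs_of_nonneg (by linarith)]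
    exact ⟨by linarith, by linarith, by linarith⟩

theorem eq_or_of_pos_mem (u v w : Gadget) (h : orient u v) (hw : pos w ∈ curve u v) :
    w = u ∨ w = v := by
  rcases u with s | _ | ⟨s, i⟩ <;> rcases v with t | _ | ⟨t, j⟩ <;> try exact h.elim
  · obtain ⟨rfl, rfl⟩ := h
    obtain ⟨h1, h2⟩ := hw
    rcases w with s | _ | ⟨s, i⟩
    · cases s <;> simp
    · norm_num [pos] at h1
    · have hi : (0 : ℝ) ≤ (i : ℕ) := Nat.cast_nonneg _
      simp only [pos] at h1
      rw [abs_sign_mul, abs_of_nonneg (by linarith)] at h1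
      linarith
  · obtain ⟨t, h0, h1, h⟩ := mem_curve_apex.mp hw
    rcases w with t | _ | ⟨t, i⟩ <;> simp only [pos, Prod.mk.injEq] at h
    · left
      rcases sign_cases s with ⟨rfl, e⟩ | ⟨rfl, e⟩ <;>
        rcases sign_cases t with ⟨rfl, e'⟩ | ⟨rfl, e'⟩ <;> first | rfl | (rw [e, e'] at h; linarith)
    · simp
    · norm_num at h
  · obtain ⟨r, h0, h1, h2⟩ := (mem_curve_leaf h).mp hw
    obtain rfl : s = t := h
    have hj : (0 : ℝ) ≤ (j : ℕ) := Nat.cast_nonneg _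
    have hm := mul_nonneg h0 hj
    rcases w with t | _ | ⟨t, i⟩
    · obtain ⟨h2, h3⟩ := Prod.mk.inj h2
      left
      rcases sign_cases s with ⟨rfl, e⟩ | ⟨rfl, e⟩ <;>
        rcases sign_cases t with ⟨rfl, e'⟩ | ⟨rfl, e'⟩ <;>
        first | rfl | (rw [e, e'] at h2; linarith)
    · obtain ⟨h2, h3⟩ := Prod.mk.inj h2
      rcases sign_cases s with ⟨rfl, e⟩ | ⟨rfl, e⟩ <;> rw [e] at h2 <;> linarith
    · right
      have hr : r = 1 := by
        have : (1 : ℝ) = 2 - r := congrArg Prod.snd h2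
        linarith
      refine pos_injective (h2.trans ?_)
      norm_num [pos, hr]

theorem eq_or_of_mem_curves (u v p q : Gadget) (h : orient u v) (h' : orient p q) (z : Pt)
    (hz : z ∈ curve u v) (hz' : z ∈ curve p q) :
    (u = p ∧ v = q) ∨ ∃ w, (w = u ∨ w = v) ∧ (w = p ∨ w = q) ∧ z = pos w := by
  have hubs_apex : ∀ s, z ∈ curve (hub true) (hub false) → z ∈ curve (hub s) apex →
      z = pos (hub s) := by
    rintro s ⟨h1, h2⟩ hz
    obtain ⟨t, h3, h4, rfl⟩ := mem_curve_apex.mp hz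
    rw [abs_sign_mul, abs_of_nonneg (by linarith)] at h1
    have : t = 0 := by linarith
    simp [pos, this]
  have hubs_leaf : ∀ s i, z ∈ curve (hub true) (hub false) → z ∈ curve (hub s) (leaf s i) →
      z = pos (hub s) := by
    rintro s i ⟨h1, h2⟩ hz
    obtain ⟨r, h3, h4, rfl⟩ := (mem_curve_leaf rfl).mp hz
    have hm := mul_nonneg h3 (Nat.cast_nonneg (α := ℝ) i)
    rw [abs_sign_mul, abs_of_nonneg (by linarith)] at h1
    have hr : r = 0 := by linarith
    simp [pos, hr]
  have apex_leaf : ∀ s t i, z ∈ curve (hub s) apex → z ∈ curve (hub t) (leaf t i) →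
      s = t ∧ z = pos (hub s) := by
    intro s t i hz hz'
    obtain ⟨r, h1, h2, rfl⟩ := mem_curve_apex.mp hz
    obtain ⟨r', h3, h4, he⟩ := (mem_curve_leaf rfl).mp hz'
    obtain ⟨he, he'⟩ := Prod.mk.inj he
    have hr : r' = 0 := by linarith
    rw [hr, zero_mul, add_zero] at he
    rcases sign_cases s with ⟨rfl, e⟩ | ⟨rfl, e⟩ <;>
      rcases sign_cases t with ⟨rfl, e'⟩ | ⟨rfl, e'⟩ <;> simp only [e, e'] at he
    · have : r = 0 := by linarith
      simp [this, pos]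
    · linarith
    · linarith
    · have : r = 0 := by linarith
      simp [this, pos]
  have hub_cases : ∀ s, hub s = hub true ∨ hub s = hub false := by
    rintro (_ | _) <;> simp
  rcases u with s | _ | ⟨s, i⟩ <;> rcases v with t | _ | ⟨t, j⟩ <;> (try exact h.elim) <;>
    rcases p with s' | _ | ⟨s', i'⟩ <;> rcases q with t' | _ | ⟨t', j'⟩ <;> try exact h'.elim
  · obtain ⟨rfl, rfl⟩ := h
    obtain ⟨rfl, rfl⟩ := h'
    exact .inl ⟨rfl, rfl⟩
  · obtain ⟨rfl, rfl⟩ := h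
    exact .inr ⟨hub s', hub_cases s', .inl rfl, hubs_apex s' hz hz'⟩
  · obtain ⟨rfl, rfl⟩ := h
    obtain rfl : s' = t' := h'
    exact .inr ⟨hub s', hub_cases s', .inl rfl, hubs_leaf s' j' hz hz'⟩
  · obtain ⟨rfl, rfl⟩ := h'
    exact .inr ⟨hub s, .inl rfl, hub_cases s, hubs_apex s hz' hz⟩
  · by_cases hs : s = s'
    · exact .inl ⟨by rw [hs], rfl⟩
    · refine .inr ⟨apex, .inr rfl, .inr rfl, ?_⟩
      obtain ⟨r, h1, h2, rfl⟩ := mem_curve_apex.mp hz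
      obtain ⟨r', h3, h4, he⟩ := mem_curve_apex.mp hz'
      have he := (Prod.mk.inj he).1
      have : r = 1 := by
        rcases sign_cases s with ⟨rfl, e⟩ | ⟨rfl, e⟩ <;>
          rcases sign_cases s' with ⟨rfl, e'⟩ | ⟨rfl, e'⟩ <;>
          first | exact absurd rfl hs | (rw [e, e'] at he; linarith)
      simp [this, pos]
  · obtain rfl : s' = t' := h'
    obtain ⟨rfl, hw⟩ := apex_leaf _ _ _ hz hz'
    exact .inr ⟨_, .inl rfl, .inl rfl, hw⟩
  · obtain ⟨rfl, rfl⟩ := h'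
    obtain rfl : s = t := h
    exact .inr ⟨hub s, .inl rfl, hub_cases s, hubs_leaf s j hz' hz⟩
  · obtain rfl : s = t := h
    obtain ⟨rfl, hw⟩ := apex_leaf _ _ _ hz' hz
    exact .inr ⟨_, .inl rfl, .inl rfl, hw⟩
  · obtain rfl : s = t := h
    obtain rfl : s' = t' := h'
    obtain ⟨r, h1, h2, rfl⟩ := (mem_curve_leaf rfl).mp hz
    obtain ⟨r', h3, h4, he⟩ := (mem_curve_leaf rfl).mp hz'
    obtain ⟨he, he'⟩ := Prod.mk.inj he
    obtain rfl : r = r' := by linarith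
    have hm := mul_nonneg h1 (Nat.cast_nonneg (α := ℝ) j)
    have hm' := mul_nonneg h1 (Nat.cast_nonneg (α := ℝ) j')
    have key : s = s' ∧ r * ((j : ℕ) : ℝ) = r * (j' : ℕ) := by
      rcases sign_cases s with ⟨rfl, e⟩ | ⟨rfl, e⟩ <;>
        rcases sign_cases s' with ⟨rfl, e'⟩ | ⟨rfl, e'⟩ <;> simp only [e, e'] at he
      · exact ⟨rfl, by linarith⟩
      · linarith
      · linarith
      · exact ⟨rfl, by linarith⟩
    obtain ⟨rfl, hk⟩ := key
    by_cases hr : r = 0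
    · exact .inr ⟨hub s, .inl rfl, .inl rfl, by simp [hr, pos]⟩
    · rw [Fin.ext (Nat.cast_injective (mul_left_cancel₀ hr hk))]
      exact .inl ⟨rfl, rfl⟩

/-- A drawing of the gadget on two rows. -/
noncomputable def sketch : Sketch graph marks 2 7 where
  R := orient
  pos := pos
  E := curve
  adj := by
    rintro (s | _ | ⟨s, i⟩) (t | _ | ⟨t, j⟩) h <;> try exact h.elim
    · cases s <;> cases t
      · exact absurd rfl h
      · exact .inr ⟨rfl, rfl⟩
      · exact .inl ⟨rfl, rfl⟩
      · exact absurd rfl h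
    · exact .inl trivial
    · exact .inl h
    · exact .inr trivial
    · exact .inr h.symm
  inj := pos_injective
  curve := isEdgeCurve_curve
  vertex := eq_or_of_pos_mem
  edge := eq_or_of_mem_curves
  row := by
    rintro (s | _ | ⟨s, i⟩)
    · exact ⟨2, by norm_num, by norm_num, by norm_num [pos]⟩
    · exact ⟨2, by norm_num, by norm_num, by norm_num [pos]⟩
    · exact ⟨1, by norm_num, by norm_num, by norm_num [pos]⟩
  width := by
    rintro (s | _ | ⟨s, i⟩)
    · have := abs_sign_mul s 1
      rw [mul_one, abs_one] at this
      simp only [pos, this]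
      norm_num
    · norm_num [pos]
    · have hi : (0 : ℝ) ≤ (i : ℕ) := Nat.cast_nonneg _
      have hi' : ((i : ℕ) : ℝ) ≤ 4 := by
        have : (i : ℕ) ≤ 4 := by omega
        exact_mod_cast this
      simp only [pos]
      rw [abs_sign_mul, abs_of_nonneg (by linarith)]
      linarith
  box u v h z hz := by exact_mod_cast mem_box u v h z hz
  top := by
    rintro _ rfl
    norm_num [pos]
  bottom := by
    rintro _ ⟨s, i, rfl⟩
    rfl

end Gadget

/-- The height of the pole `s` in the polar construction. -/
def poleHeight (h : ℕ) (s : Bool) : ℝ := if s then h + 2 else 1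

namespace Sketch

variable {V : Type} {G : SimpleGraph V} {M : Bool → Set V} {h : ℕ} {W : ℝ}

/-- The positions in the polar construction. -/
def polarPos (K : Sketch G M h W) : Bool ⊕ Fin 7 × V → Pt
  | .inl s => (0, poleHeight h s)
  | .inr (i, x) => K.pos x + (2 * W * (i : ℕ), 1)

/-- The orientation of the edges in the polar construction. -/
def polarOrient (K : Sketch G M h W) : Bool ⊕ Fin 7 × V → Bool ⊕ Fin 7 × V → Prop
  | .inl s, .inr (_, x) => x ∈ M s
  | .inr (i, x), .inr (j, y) => i = j ∧ K.R x y
  | _, _ => False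

/-- The curves of the edges in the polar construction. -/
def polarCurve (K : Sketch G M h W) : Bool ⊕ Fin 7 × V → Bool ⊕ Fin 7 × V → Set Pt
  | .inr (i, x), .inr (_, y) => (· + (2 * W * (i : ℕ), 1)) '' K.E x y
  | u, v => segment ℝ (K.polarPos u) (K.polarPos v)

theorem index_eq_of_abs_lt {a b : ℝ} (ha : |a| < W) (hb : |b| < W) {i j : Fin 7}
    (he : a + 2 * W * (i : ℕ) = b + 2 * W * (j : ℕ)) : i = j := by
  have hW : 0 < W := (abs_nonneg a).trans_lt ha
  obtain ⟨ha1, ha2⟩ := abs_lt.mp ha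
  obtain ⟨hb1, hb2⟩ := abs_lt.mp hb
  have aux : ∀ m n : ℕ, m < n → 2 * W * m + 2 * W ≤ 2 * W * n := by
    intro m n hmn
    have : (m : ℝ) + 1 ≤ n := by exact_mod_cast hmn
    nlinarith
  rcases lt_trichotomy (i : ℕ) (j : ℕ) with hij | hij | hij
  · linarith [aux _ _ hij]
  · exact Fin.ext hij
  · linarith [aux _ _ hij]

theorem pos_snd_mem (K : Sketch G M h W) (x : V) : 1 ≤ (K.pos x).2 ∧ (K.pos x).2 ≤ h := by
  obtain ⟨k, h1, h2, h3⟩ := K.row x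
  rw [h3]
  exact ⟨by exact_mod_cast h1, by exact_mod_cast h2⟩

theorem polarPos_inr_ne (K : Sketch G M h W) (s : Bool) (i : Fin 7) (x : V) :
    K.polarPos (.inl s) ≠ K.polarPos (.inr (i, x)) := by
  intro he
  have he := congrArg Prod.snd he
  obtain ⟨h1, h2⟩ := K.pos_snd_mem x
  cases s <;> simp [polarPos, poleHeight] at he <;> linarith

theorem polarPos_injective (K : Sketch G M h W) : Function.Injective K.polarPos := by
  rintro (s | ⟨i, x⟩) (t | ⟨j, y⟩) he
  · have he := congrArg Prod.snd he
    have : (0 : ℝ) ≤ h := Nat.cast_nonneg h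
    cases s <;> cases t <;> simp [polarPos, poleHeight] at he ⊢ <;> linarith
  · exact absurd he (K.polarPos_inr_ne s j y)
  · exact absurd he.symm (K.polarPos_inr_ne t i x)
  · obtain rfl := index_eq_of_abs_lt (K.width x) (K.width y) (congrArg Prod.fst he)
    rw [K.inj (add_right_cancel he)]

theorem mem_polarCurve_pole (K : Sketch G M h W) {s : Bool} {i : Fin 7} {x : V} (hx : x ∈ M s)
    {z : Pt} (hz : z ∈ K.polarCurve (.inl s) (.inr (i, x))) :
    ∃ t : ℝ, 0 ≤ t ∧ t ≤ 1 ∧ z.1 = t * (K.polarPos (.inr (i, x))).1 ∧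
      z.2 = poleHeight h s + t * (if s then -1 else 1) := by
  obtain ⟨t, h0, h1, rfl⟩ := mem_segment_iff_exists.mp hz
  refine ⟨t, h0, h1, by simp [polarPos], ?_⟩
  cases s
  · simp [polarPos, poleHeight, K.bottom x hx]
  · simp only [polarPos, poleHeight, if_true, Prod.snd_add, K.top x hx]
    ring

theorem eq_polarPos_of_mem_polarCurve (K : Sketch G M h W) {s : Bool} {i : Fin 7} {x : V}
    (hx : x ∈ M s) {z : Pt} (hz : z ∈ K.polarCurve (.inl s) (.inr (i, x)))
    (h2 : 2 ≤ z.2) (hh : z.2 ≤ h + 1) : z = K.polarPos (.inr (i, x)) := by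
  obtain ⟨t, h0, h1, he, he'⟩ := K.mem_polarCurve_pole hx hz
  have ht : t = 1 := by
    cases s <;> simp [poleHeight] at he' <;> linarith
  subst ht
  refine Prod.ext (by simpa using he) ?_
  rw [he']
  cases s
  · simp [polarPos, poleHeight, K.bottom x hx]
  · simp [polarPos, poleHeight, K.top x hx]; ring

theorem polarPos_inr_snd_mem (K : Sketch G M h W) (i : Fin 7) (x : V) :
    2 ≤ (K.polarPos (.inr (i, x))).2 ∧ (K.polarPos (.inr (i, x))).2 ≤ h + 1 := by
  obtain ⟨h1, h2⟩ := K.pos_snd_mem x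
  simp only [polarPos, Prod.snd_add]
  exact ⟨by linarith, by linarith⟩

theorem eq_or_of_polarPos_mem (K : Sketch G M h W) (hh : 2 ≤ h) (u v w : Bool ⊕ Fin 7 × V)
    (hR : K.polarOrient u v) (hw : K.polarPos w ∈ K.polarCurve u v) : w = u ∨ w = v := by
  have hh' : (2 : ℝ) ≤ h := by exact_mod_cast hh
  rcases u with s | ⟨i, x⟩ <;> rcases v with t | ⟨j, y⟩ <;> try exact hR.elim
  · rcases w with t | ⟨k, z⟩
    · obtain ⟨r, h0, h1, -, he⟩ := K.mem_polarCurve_pole hR hw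
      left
      cases s <;> cases t <;> simp [polarPos, poleHeight] at he ⊢ <;> linarith
    · obtain ⟨h1, h2⟩ := K.polarPos_inr_snd_mem k z
      exact .inr (K.polarPos_injective (K.eq_polarPos_of_mem_polarCurve hR hw h1 h2))
  · obtain ⟨rfl, hR⟩ := hR
    obtain ⟨p, hp, he⟩ := hw
    obtain ⟨h1, h2, h3⟩ := K.box _ _ hR p hp
    rcases w with t | ⟨k, z⟩
    · have he := congrArg Prod.snd he
      cases t <;> simp [polarPos, poleHeight] at he <;> linarith
    · obtain rfl := index_eq_of_abs_lt h1 (K.width z) (congrArg Prod.fst he)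
      obtain rfl : p = K.pos z := add_right_cancel he
      rcases K.vertex _ _ z hR hp with rfl | rfl
      · exact .inl rfl
      · exact .inr rfl

theorem eq_or_of_mem_polarCurves (K : Sketch G M h W) (hh : 2 ≤ h) (u v p q : Bool ⊕ Fin 7 × V)
    (hR : K.polarOrient u v) (hR' : K.polarOrient p q) (z : Pt) (hz : z ∈ K.polarCurve u v)
    (hz' : z ∈ K.polarCurve p q) :
    (u = p ∧ v = q) ∨ ∃ w, (w = u ∨ w = v) ∧ (w = p ∨ w = q) ∧ z = K.polarPos w := by
  have hh' : (2 : ℝ) ≤ h := by exact_mod_cast hh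
  have pole_copy : ∀ s i x j y y', x ∈ M s → K.R y y' →
      z ∈ K.polarCurve (.inl s) (.inr (i, x)) → z ∈ K.polarCurve (.inr (j, y)) (.inr (j, y')) →
      z = K.polarPos (.inr (i, x)) ∧
        ((.inr (i, x) : Bool ⊕ Fin 7 × V) = .inr (j, y) ∨
          (.inr (i, x) : Bool ⊕ Fin 7 × V) = .inr (j, y')) := by
    intro s i x j y y' hx hy hz hz'
    have he : z = K.polarPos (.inr (i, x)) := by
      obtain ⟨p, hp, rfl⟩ := hz'
      obtain ⟨-, h1, h2⟩ := K.box _ _ hy p hp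
      apply K.eq_polarPos_of_mem_polarCurve hx hz
      · simp only [Prod.snd_add]; linarith
      · simp only [Prod.snd_add]; linarith
    exact ⟨he, K.eq_or_of_polarPos_mem hh (.inr (j, y)) (.inr (j, y')) _ ⟨rfl, hy⟩ (he ▸ hz')⟩
  rcases u with s | ⟨i, x⟩ <;> rcases v with t | ⟨j, y⟩ <;> (try exact hR.elim) <;>
    rcases p with s' | ⟨i', x'⟩ <;> rcases q with t' | ⟨j', y'⟩ <;> try exact hR'.elim
  · obtain ⟨r, h0, h1, h2, h3⟩ := K.mem_polarCurve_pole hR hz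
    obtain ⟨r', h0', h1', h2', h3'⟩ := K.mem_polarCurve_pole hR' hz'
    have hs : s = s' ∧ r = r' := by
      rw [h3] at h3'
      cases s <;> cases s' <;> simp [poleHeight] at h3' ⊢ <;> linarith
    obtain ⟨rfl, rfl⟩ := hs
    by_cases hr : r = 0
    · refine .inr ⟨.inl s, .inl rfl, .inl rfl, Prod.ext ?_ ?_⟩
      · simp [h2, hr, polarPos]
      · simp [h3, hr, polarPos]
    · left
      refine ⟨rfl, K.polarPos_injective (Prod.ext (mul_left_cancel₀ hr (h2.symm.trans h2')) ?_)⟩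
      cases s
      · simp [polarPos, K.bottom y hR, K.bottom y' hR']
      · simp [polarPos, K.top y hR, K.top y' hR']
  · obtain ⟨rfl, hR'⟩ := hR'
    obtain ⟨h1, h2⟩ := pole_copy _ _ _ _ _ _ hR hR' hz hz'
    exact .inr ⟨_, .inr rfl, h2, h1⟩
  · obtain ⟨rfl, hR⟩ := hR
    obtain ⟨h1, h2⟩ := pole_copy _ _ _ _ _ _ hR' hR hz' hz
    exact .inr ⟨_, h2, .inr rfl, h1⟩
  · obtain ⟨rfl, hR⟩ := hR
    obtain ⟨rfl, hR'⟩ := hR'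
    obtain ⟨a, ha, rfl⟩ := hz
    obtain ⟨b, hb, he⟩ := hz'
    obtain rfl := index_eq_of_abs_lt (K.box _ _ hR' b hb).1 (K.box _ _ hR a ha).1
      (congrArg Prod.fst he)
    obtain rfl := add_right_cancel he
    rcases K.edge _ _ _ _ hR hR' _ ha hb with ⟨rfl, rfl⟩ | ⟨w, h1, h2, rfl⟩
    · exact .inl ⟨rfl, rfl⟩
    · exact .inr ⟨.inr (i', w), by simpa using h1, by simpa using h2, rfl⟩

theorem polar_width (hW : 0 < W) (i : Fin 7) {a : ℝ} (ha : |a| < W) :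
    |a + 2 * W * (i : ℕ)| < 14 * W := by
  obtain ⟨h1, h2⟩ := abs_lt.mp ha
  have hi : (0 : ℝ) ≤ (i : ℕ) := Nat.cast_nonneg _
  have hi' : ((i : ℕ) : ℝ) ≤ 6 := by
    have : (i : ℕ) ≤ 6 := by omega
    exact_mod_cast this
  rw [abs_lt]
  constructor <;> nlinarith

/-- Two poles can be added at the expense of two rows. -/
def polar (K : Sketch G M h W) (hh : 2 ≤ h) (hW : 0 < W) :
    Sketch (polarGraph G M) (poleMarks V) (h + 2) (14 * W) where
  R := K.polarOrient
  pos := K.polarPos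
  E := K.polarCurve
  adj := by
    rintro (s | ⟨i, x⟩) (t | ⟨j, y⟩) he
    · exact he.elim
    · exact .inl he
    · exact .inr he
    · exact (K.adj _ _ he.2).imp (⟨he.1, ·⟩) (⟨he.1.symm, ·⟩)
  inj := K.polarPos_injective
  curve := by
    rintro (s | ⟨i, x⟩) (t | ⟨j, y⟩) hR <;> try exact hR.elim
    · exact isEdgeCurve_segment _ (K.polarPos_inr_ne _ _ _)
    · obtain ⟨rfl, hR⟩ := hR
      exact (K.curve _ _ hR).translate _
  vertex := K.eq_or_of_polarPos_mem hh
  edge := K.eq_or_of_mem_polarCurves hh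
  row := by
    rintro (s | ⟨i, x⟩)
    · cases s
      · exact ⟨1, le_rfl, by push_cast; omega, by simp [polarPos, poleHeight]⟩
      · exact ⟨h + 2, by omega, by push_cast; omega, by simp [polarPos, poleHeight]⟩
    · obtain ⟨k, h1, h2, h3⟩ := K.row x
      exact ⟨k + 1, by omega, by push_cast; omega, by simp [polarPos, h3]⟩
  width := by
    rintro (s | ⟨i, x⟩)
    · simp [polarPos, hW]
    · exact polar_width hW i (K.width x)
  box := by
    rintro (s | ⟨i, x⟩) (t | ⟨j, y⟩) hR z hz <;> try exact hR.elim
    · obtain ⟨r, h0, h1, h2, h3⟩ := K.mem_polarCurve_pole hR hz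
      refine ⟨?_, ?_⟩
      · rw [h2, abs_mul, abs_of_nonneg h0]
        exact (mul_le_of_le_one_left (abs_nonneg _) h1).trans_lt (polar_width hW j (K.width y))
      · have hh' : (2 : ℝ) ≤ h := by exact_mod_cast hh
        rw [h3]
        cases s <;> simp [poleHeight] <;> constructor <;> linarith
    · obtain ⟨rfl, hR⟩ := hR
      obtain ⟨p, hp, rfl⟩ := hz
      obtain ⟨h1, h2, h3⟩ := K.box _ _ hR p hp
      refine ⟨polar_width hW i h1, ?_⟩
      simp only [Prod.snd_add]
      push_cast
      exact ⟨by linarith, by linarith⟩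
  top := by
    rintro _ rfl
    simp [polarPos, poleHeight]
  bottom := by
    rintro _ rfl
    simp [polarPos, poleHeight]

end Sketch

/-- There is a (finite) simple graph admitting a planar poly-line
drawing of height 6 but no planar `y`-monotone poly-line drawing of height 6. -/
theorem stmt10 :
    ∃ (V : Type) (_ : Fintype V) (G : SimpleGraph V),
      (∃ Γ : PolyDrawing G, Γ.IsPlanar ∧ Γ.HasHeight 6) ∧
      ¬ ∃ Γ : PolyDrawing G, Γ.IsPlanar ∧ Γ.IsYMonotone ∧ Γ.HasHeight 6 := by
  refine ⟨_, Fintype.ofFinite _,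
    polarGraph (polarGraph Gadget.graph Gadget.marks) (poleMarks Gadget),
    ((Gadget.sketch.polar le_rfl (by norm_num)).polar (by norm_num)
      (by norm_num)).exists_polyDrawing, ?_⟩
  rintro ⟨Γ, hp, hm, hn⟩
  obtain ⟨D, hD⟩ := Γ.exists_levelDrawing hp hm hn
  exact false_of_six_rows D (fun v => (hD v).1) (fun v => (hD v).2)
end

section
/- There exists a simple graph G that admits a planar poly-line drawing of height 6 but admits no planar straight-line drawing in which every vertex has an integer y-coordinate in {1,…,6}. -/
open Set

/-- `w` lies strictly inside the triangle `p q r`. -/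
def InTri (p q r w : Pt) : Prop :=
  ∃ a b c : ℝ, 0 < a ∧ 0 < b ∧ 0 < c ∧ a + b + c = 1 ∧ w = a • p + b • q + c • r

theorem InTri.swap {p q r w : Pt} (h : InTri p q r w) : InTri q p r w := by
  obtain ⟨a, b, c, ha, hb, hc, hs, rfl⟩ := h
  exact ⟨b, a, c, hb, ha, hc, by linarith, by module⟩

theorem InTri.rotate {p q r w : Pt} (h : InTri p q r w) : InTri q r p w := by
  obtain ⟨a, b, c, ha, hb, hc, hs, rfl⟩ := h
  exact ⟨b, c, a, hb, hc, ha, by linarith, by module⟩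

theorem exists_barycentric_of_det_ne_zero {p q r : Pt}
    (h : (q.1 - p.1) * (r.2 - p.2) - (q.2 - p.2) * (r.1 - p.1) ≠ 0) (w : Pt) :
    ∃ a b c : ℝ, a + b + c = 1 ∧ w = a • p + b • q + c • r := by
  set D := (q.1 - p.1) * (r.2 - p.2) - (q.2 - p.2) * (r.1 - p.1) with hD
  set b := ((w.1 - p.1) * (r.2 - p.2) - (w.2 - p.2) * (r.1 - p.1)) / D with hb
  set c := ((q.1 - p.1) * (w.2 - p.2) - (q.2 - p.2) * (w.1 - p.1)) / D with hc
  have hb' : b * D = (w.1 - p.1) * (r.2 - p.2) - (w.2 - p.2) * (r.1 - p.1) := by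
    rw [hb]; field_simp
  have hc' : c * D = (q.1 - p.1) * (w.2 - p.2) - (q.2 - p.2) * (w.1 - p.1) := by
    rw [hc]; field_simp
  refine ⟨1 - b - c, b, c, by ring, ?_⟩
  ext
  · simp only [Prod.fst_add, Prod.smul_fst, smul_eq_mul]
    apply mul_left_cancel₀ h
    linear_combination (p.1 - q.1) * hb' + (p.1 - r.1) * hc' + (w.1 - p.1) * hD
  · simp only [Prod.snd_add, Prod.smul_snd, smul_eq_mul]
    apply mul_left_cancel₀ h
    linear_combination (p.2 - q.2) * hb' + (p.2 - r.2) * hc' + (w.2 - p.2) * hD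

theorem mem_segment_of_det_eq_zero {p q r : Pt}
    (h : (q.1 - p.1) * (r.2 - p.2) - (q.2 - p.2) * (r.1 - p.1) = 0) :
    r ∈ segment ℝ p q ∨ q ∈ segment ℝ p r ∨ p ∈ segment ℝ q r := by
  by_cases hpq : p = q
  · exact Or.inr (Or.inl (hpq ▸ left_mem_segment ℝ p r))
  have hcol : Collinear ℝ {p, q, r} := by
    rw [collinear_iff_of_mem (p₀ := p) (by simp)]
    refine ⟨q - p, ?_⟩
    have hr : ∃ t : ℝ, r = t • (q - p) +ᵥ p := by
      by_cases hx : q.1 - p.1 = 0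
      · have hy : q.2 - p.2 ≠ 0 := by
          intro hy
          exact hpq (Prod.ext (by linarith) (by linarith))
        refine ⟨(r.2 - p.2) / (q.2 - p.2), ?_⟩
        ext
        · rw [hx] at h
          have : r.1 - p.1 = 0 := by
            have : (q.2 - p.2) * (r.1 - p.1) = 0 := by linarith
            exact (mul_eq_zero.mp this).resolve_left hy
          simp [hx]; linarith
        · simp; field_simp; ring
      · refine ⟨(r.1 - p.1) / (q.1 - p.1), ?_⟩
        ext
        · simp; field_simp; ring
        · simp; field_simp; linarith
    rintro x (rfl | rfl | rfl)
    · exact ⟨0, by simp⟩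
    · exact ⟨1, by simp⟩
    · exact hr
  rcases hcol.wbtw_or_wbtw_or_wbtw with h | h | h
  · exact Or.inr (Or.inl (mem_segment_iff_wbtw.mpr h))
  · exact Or.inl (segment_symm ℝ q p ▸ mem_segment_iff_wbtw.mpr h)
  · exact Or.inr (Or.inr (segment_symm ℝ r q ▸ mem_segment_iff_wbtw.mpr h))

/-- A segment that leaves the interior of a triangle through the side `q r`. -/
theorem exists_mem_segment_of_exit {p q r u w : Pt} {a b c a' b' c' : ℝ}
    (ha : 0 < a) (hs : a + b + c = 1) (hu : u = a • p + b • q + c • r)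
    (hs' : a' + b' + c' = 1) (hw : w = a' • p + b' • q + c' • r)
    (ha' : a' ≤ 0) (hb' : b * a' ≤ b' * a) (hc' : c * a' ≤ c' * a) :
    ∃ x, x ∈ segment ℝ u w ∧ x ∈ segment ℝ q r := by
  have hd : 0 < a - a' := by linarith
  refine ⟨(-a' / (a - a')) • u + (a / (a - a')) • w,
    ⟨_, _, div_nonneg (by linarith) hd.le, div_nonneg ha.le hd.le, by field_simp; ring, rfl⟩,
    ⟨(b' * a - b * a') / (a - a'), (c' * a - c * a') / (a - a'),
      div_nonneg (by linarith) hd.le, div_nonneg (by linarith) hd.le, ?_, ?_⟩⟩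
  · field_simp
    linear_combination a * hs' - a' * hs
  · subst hu hw
    match_scalars <;> field_simp <;> ring

/-- If the first barycentric coordinate of `w` is the least relative to those of `s`, then `w`
lies in the triangle spanned by `s` and the other two corners. -/
theorem inTri_or_mem_segment {p q r s w : Pt} {a b c a' b' c' : ℝ} (ha : 0 < a) (hb : 0 < b)
    (hc : 0 < c) (ha' : 0 < a') (hsum : a + b + c = 1) (hsum' : a' + b' + c' = 1)
    (hs : s = a • p + b • q + c • r) (hw : w = a' • p + b' • q + c' • r)
    (h1 : a' / a ≤ b' / b) (h2 : a' / a ≤ c' / c) :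
    InTri q r s w ∨ w ∈ segment ℝ q s ∨ w ∈ segment ℝ r s := by
  obtain ⟨k, hk, hka⟩ : ∃ k, 0 < k ∧ k = a' / a := ⟨_, div_pos ha' ha, rfl⟩
  rw [← hka, le_div_iff₀ hb] at h1
  rw [← hka, le_div_iff₀ hc] at h2
  rw [eq_div_iff ha.ne'] at hka
  have hws : w = (b' - k * b) • q + (c' - k * c) • r + k • s := by
    rw [hs, hw, ← hka]; module
  have hone : b' - k * b + (c' - k * c) + k = 1 := by
    linear_combination hsum' - k * hsum + hka
  rcases h1.eq_or_lt with h1 | h1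
  · refine Or.inr (Or.inr ⟨c' - k * c, k, by linarith, hk.le, by linarith, ?_⟩)
    rw [hws, h1]; module
  rcases h2.eq_or_lt with h2 | h2
  · refine Or.inr (Or.inl ⟨b' - k * b, k, by linarith, hk.le, by linarith, ?_⟩)
    rw [hws, h2]; module
  · exact Or.inl ⟨_, _, k, by linarith, by linarith, hk, hone, hws⟩

namespace StraightDrawing

variable {V : Type} {G : SimpleGraph V} {Γ : StraightDrawing G}

theorem IsPlanar.notMem_segment (hΓ : Γ.IsPlanar) {u v w : V} (h : G.Adj u v)
    (hu : w ≠ u) (hv : w ≠ v) : Γ.pos w ∉ segment ℝ (Γ.pos u) (Γ.pos v) :=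
  hΓ.1 w s(u, v) h (by simp [hu, hv])

theorem IsPlanar.notMem_of_disjoint (hΓ : Γ.IsPlanar) {u v w z : V} (h : G.Adj u v)
    (h' : G.Adj w z) (huw : u ≠ w) (huz : u ≠ z) (hvw : v ≠ w) (hvz : v ≠ z) {x : Pt}
    (hx : x ∈ segment ℝ (Γ.pos u) (Γ.pos v)) : x ∉ segment ℝ (Γ.pos w) (Γ.pos z) := by
  intro hx'
  obtain ⟨y, hy, hy', -⟩ := hΓ.2 s(u, v) h s(w, z) h' (by simp [huw, huz]) x ⟨hx, hx'⟩
  simp only [Sym2.mem_iff] at hy hy'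
  grind

/-- The interior of the drawn triangle `p q r` contains the point of `w`. -/
def Inside (Γ : StraightDrawing G) (p q r w : V) : Prop :=
  InTri (Γ.pos p) (Γ.pos q) (Γ.pos r) (Γ.pos w)

theorem Inside.swap {p q r w : V} (h : Γ.Inside p q r w) : Γ.Inside q p r w := InTri.swap h

theorem Inside.rotate {p q r w : V} (h : Γ.Inside p q r w) : Γ.Inside q r p w := InTri.rotate h

theorem IsPlanar.exists_barycentric (hΓ : Γ.IsPlanar) {p q r : V} (hpq : G.Adj p q)
    (hqr : G.Adj q r) (hpr : G.Adj p r) (w : Pt) :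
    ∃ a b c : ℝ, a + b + c = 1 ∧ w = a • Γ.pos p + b • Γ.pos q + c • Γ.pos r := by
  apply exists_barycentric_of_det_ne_zero
  intro h
  rcases mem_segment_of_det_eq_zero h with h | h | h
  · exact hΓ.notMem_segment hpq hpr.ne' hqr.ne' h
  · exact hΓ.notMem_segment hpr hpq.ne' hqr.ne h
  · exact hΓ.notMem_segment hqr hpq.ne hpr.ne h

/-- A neighbour of a vertex inside a triangle is inside the triangle or one of its corners. -/
theorem IsPlanar.inside_of_adj (hΓ : Γ.IsPlanar) {p q r u w : V} (hpq : G.Adj p q)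
    (hqr : G.Adj q r) (hpr : G.Adj p r) (hu : Γ.Inside p q r u) (huw : G.Adj u w)
    (hup : u ≠ p) (huq : u ≠ q) (hur : u ≠ r) (hwp : w ≠ p) (hwq : w ≠ q) (hwr : w ≠ r) :
    Γ.Inside p q r w := by
  obtain ⟨a, b, c, ha, hb, hc, hs, hu⟩ := hu
  obtain ⟨a', b', c', hs', hw⟩ := hΓ.exists_barycentric hpq hqr hpr (Γ.pos w)
  have key (x y : V) (hxy : G.Adj x y) (hux : u ≠ x) (huy : u ≠ y) (hwx : w ≠ x) (hwy : w ≠ y) :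
      ¬ ∃ z, z ∈ segment ℝ (Γ.pos u) (Γ.pos w) ∧ z ∈ segment ℝ (Γ.pos x) (Γ.pos y) :=
    fun ⟨_, hz, hz'⟩ => hΓ.notMem_of_disjoint huw hxy hux huy hwx hwy hz hz'
  by_contra hcon
  have hneg : a' ≤ 0 ∨ b' ≤ 0 ∨ c' ≤ 0 := by
    by_contra! h
    exact hcon ⟨a', b', c', h.1, h.2.1, h.2.2, hs', hw⟩
  have hdiv {x y x' y' : ℝ} (hx : 0 < x) (hy : 0 < y) (h : x' / x ≤ y' / y) :
      y * x' ≤ y' * x := by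
    rw [div_le_div_iff₀ hx hy] at h; linarith
  have hmin : (a' / a ≤ b' / b ∧ a' / a ≤ c' / c) ∨ (b' / b ≤ a' / a ∧ b' / b ≤ c' / c) ∨
      (c' / c ≤ a' / a ∧ c' / c ≤ b' / b) := by grind
  have hsign {x y x' y' : ℝ} (hx : 0 < x) (hy : 0 < y) (h : x' / x ≤ y' / y) (hy' : y' ≤ 0) :
      x' ≤ 0 := by
    have := hdiv hx hy h
    by_contra! hx'
    nlinarith [mul_pos hy hx', mul_nonneg (neg_nonneg.mpr hy') hx.le]
  rcases hmin with ⟨h1, h2⟩ | ⟨h1, h2⟩ | ⟨h1, h2⟩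
  · exact key q r hqr huq hur hwq hwr (exists_mem_segment_of_exit ha hs hu hs' hw
      (by rcases hneg with h | h | h
          exacts [h, hsign ha hb h1 h, hsign ha hc h2 h]) (hdiv ha hb h1) (hdiv ha hc h2))
  · exact key p r hpr hup hur hwp hwr (exists_mem_segment_of_exit (p := Γ.pos q)
      (b := a) (c := c) (b' := a') (c' := c') hb (by linarith) (by rw [hu]; module)
      (by linarith) (by rw [hw]; module)
      (by rcases hneg with h | h | h
          exacts [hsign hb ha h1 h, h, hsign hb hc h2 h]) (hdiv hb ha h1) (hdiv hb hc h2))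
  · exact key p q hpq hup huq hwp hwq (exists_mem_segment_of_exit (p := Γ.pos r)
      (b := a) (c := b) (b' := a') (c' := b') hc (by linarith) (by rw [hu]; module)
      (by linarith) (by rw [hw]; module)
      (by rcases hneg with h | h | h
          exacts [hsign hc ha h1 h, hsign hc hb h2 h, h]) (hdiv hc ha h1) (hdiv hc hb h2))

/-- If `s` is stacked into the triangle `p q r`, then `w` is not inside the triangle `q r s`
if it is adjacent to `p`. -/
theorem IsPlanar.not_inside_of_adj (hΓ : Γ.IsPlanar) {p q r s w : V} (hqr : G.Adj q r)
    (hrs : G.Adj r s) (hqs : G.Adj q s) (hs : Γ.Inside p q r s) (hwp : G.Adj w p)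
    (hwq : w ≠ q) (hwr : w ≠ r) (hws : w ≠ s) (hpq : p ≠ q) (hpr : p ≠ r) (hps : p ≠ s) :
    ¬ Γ.Inside q r s w := by
  intro h
  obtain ⟨a, b, c, ha, hb, hc, habc, hp⟩ :=
    hΓ.inside_of_adj hqr hrs hqs h hwp hwq hwr hws hpq hpr hps
  obtain ⟨a', b', c', ha', hb', hc', habc', hs⟩ := hs
  have hlt : 0 < 1 - c * a' := by nlinarith
  refine hΓ.notMem_segment hqr hpq hpr ⟨(a + c * b') / (1 - c * a'), (b + c * c') / (1 - c * a'),
    by positivity, by positivity, ?_, ?_⟩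
  · field_simp
    linear_combination habc + c * habc'
  · have : (1 - c * a') • Γ.pos p = (a + c * b') • Γ.pos q + (b + c * c') • Γ.pos r := by
      have h1 : Γ.pos p = a • Γ.pos q + b • Γ.pos r + c • (a' • Γ.pos p + b' • Γ.pos q +
        c' • Γ.pos r) := by rw [← hs]; exact hp
      rw [sub_smul, one_smul]
      nth_rewrite 1 [h1]
      module
    rw [div_eq_inv_mul, div_eq_inv_mul, mul_smul, mul_smul, ← smul_add, ← this, smul_smul,
      inv_mul_cancel₀ hlt.ne', one_smul]

/-- A vertex adjacent to `p`, `q` and a vertex `s` stacked into the triangle `p q r` is inside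
the triangle `p q s`. -/
theorem IsPlanar.inside_of_stacked (hΓ : Γ.IsPlanar) {p q r s w : V} (hpq : G.Adj p q)
    (hqr : G.Adj q r) (hpr : G.Adj p r) (hps : G.Adj p s) (hqs : G.Adj q s) (hrs : G.Adj r s)
    (hs : Γ.Inside p q r s) (hwp : G.Adj w p) (hwq : G.Adj w q) (hws : G.Adj w s) (hwr : w ≠ r) :
    Γ.Inside p q s w := by
  have hw := hΓ.inside_of_adj hpq hqr hpr hs hws.symm hps.ne' hqs.ne' hrs.ne' hwp.ne hwq.ne hwr
  have n1 := hΓ.not_inside_of_adj hqr hrs hqs hs hwp hwq.ne hwr hws.ne hpq.ne hpr.ne hps.ne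
  have n2 := hΓ.not_inside_of_adj hpr hrs hps hs.swap hwq hwp.ne hwr hws.ne hpq.ne' hqr.ne hqs.ne
  have e1 := hΓ.notMem_segment hps hwp.ne hws.ne
  have e2 := hΓ.notMem_segment hqs hwq.ne hws.ne
  have e3 := hΓ.notMem_segment hrs hwr hws.ne
  obtain ⟨a, b, c, ha, hb, hc, habc, hs⟩ := hs
  obtain ⟨a', b', c', ha', hb', hc', habc', hw⟩ := hw
  have hmin : (a' / a ≤ b' / b ∧ a' / a ≤ c' / c) ∨ (b' / b ≤ a' / a ∧ b' / b ≤ c' / c) ∨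
      (c' / c ≤ a' / a ∧ c' / c ≤ b' / b) := by grind
  rcases hmin with ⟨h1, h2⟩ | ⟨h1, h2⟩ | ⟨h1, h2⟩
  · rcases inTri_or_mem_segment ha hb hc ha' habc habc' hs hw h1 h2 with h | h | h
    exacts [(n1 h).elim, (e2 h).elim, (e3 h).elim]
  · rcases inTri_or_mem_segment (p := Γ.pos q) (q := Γ.pos p) (r := Γ.pos r)
      (s := Γ.pos s) (w := Γ.pos w) hb ha hc hb'
      (by linarith) (by linarith) (by rw [hs]; module) (by rw [hw]; module) h1 h2 with h | h | h
    exacts [(n2 h).elim, (e1 h).elim, (e3 h).elim]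
  · rcases inTri_or_mem_segment (p := Γ.pos r) (q := Γ.pos p) (r := Γ.pos q)
      (s := Γ.pos s) (w := Γ.pos w) hc ha hb hc'
      (by linarith) (by linarith) (by rw [hs]; module) (by rw [hw]; module) h1 h2 with h | h | h
    exacts [h, (e1 h).elim, (e2 h).elim]

/-- A vertex adjacent to all corners of a triangle but not inside it sees one of the corners
inside the triangle that it spans with the other two. -/
theorem IsPlanar.inside_or_of_adj (hΓ : Γ.IsPlanar) {p q r x : V} (hpq : G.Adj p q)
    (hqr : G.Adj q r) (hpr : G.Adj p r) (hxp : G.Adj x p) (hxq : G.Adj x q) (hxr : G.Adj x r) :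
    Γ.Inside p q r x ∨ Γ.Inside q r x p ∨ Γ.Inside p r x q ∨ Γ.Inside p q x r := by
  obtain ⟨a, b, c, hs, hx⟩ := hΓ.exists_barycentric hpq hqr hpr (Γ.pos x)
  have cross {y z w : V} {a b c : ℝ} (hyz : G.Adj y z) (hxw : G.Adj x w) (hxy : x ≠ y)
      (hxz : x ≠ z) (hwy : w ≠ y) (hwz : w ≠ z) (ha : 0 ≤ a) (hb : 0 ≤ b) (hc : c ≤ 0)
      (hs : a + b + c = 1) (hx : Γ.pos x = a • Γ.pos y + b • Γ.pos z + c • Γ.pos w) : False := by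
    have hab : 0 < a + b := by linarith
    refine hΓ.notMem_of_disjoint hxw hyz hxy hxz hwy hwz
      (x := (a / (a + b)) • Γ.pos y + (b / (a + b)) • Γ.pos z)
      ⟨1 / (a + b), -c / (a + b), by positivity, div_nonneg (by linarith) hab.le,
        by rw [← add_div, div_eq_one_iff_eq hab.ne']; linarith, ?_⟩
      ⟨_, _, div_nonneg ha hab.le, div_nonneg hb hab.le, by field_simp, rfl⟩
    rw [hx]
    match_scalars <;> field_simp
    ring
  have corner {y z w : V} {a b c : ℝ} (hb : b < 0) (hc : c < 0) (hs : a + b + c = 1)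
      (hx : Γ.pos x = a • Γ.pos y + b • Γ.pos z + c • Γ.pos w) : Γ.Inside z w x y := by
    have ha : 0 < a := by linarith
    refine ⟨-b / a, -c / a, 1 / a, div_pos (by linarith) ha, div_pos (by linarith) ha,
      by positivity, by field_simp; linarith, ?_⟩
    rw [hx]
    match_scalars <;> field_simp <;> ring
  have hx1 : Γ.pos x = b • Γ.pos q + a • Γ.pos p + c • Γ.pos r := by rw [hx]; module
  have hx2 : Γ.pos x = c • Γ.pos r + a • Γ.pos p + b • Γ.pos q := by rw [hx]; module
  have hx3 : Γ.pos x = b • Γ.pos q + c • Γ.pos r + a • Γ.pos p := by rw [hx]; module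
  have hx4 : Γ.pos x = a • Γ.pos p + c • Γ.pos r + b • Γ.pos q := by rw [hx]; module
  have no3 (hc : c ≤ 0) (ha : 0 ≤ a) (hb : 0 ≤ b) : False :=
    cross hpq hxr hxp.ne hxq.ne hpr.ne' hqr.ne' ha hb hc hs hx
  have no2 (hb : b ≤ 0) (ha : 0 ≤ a) (hc : 0 ≤ c) : False :=
    cross hpr hxq hxp.ne hxr.ne hpq.ne' hqr.ne ha hc hb (by linarith) hx4
  have no1 (ha : a ≤ 0) (hb : 0 ≤ b) (hc : 0 ≤ c) : False :=
    cross hqr hxp hxq.ne hxr.ne hpq.ne hpr.ne hb hc ha (by linarith) hx3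
  rcases lt_or_ge a 0 with ha | ha <;> rcases lt_or_ge b 0 with hb | hb <;>
    rcases lt_or_ge c 0 with hc | hc
  · linarith
  · exact Or.inr (Or.inr (Or.inr (corner ha hb (by linarith) hx2)))
  · exact Or.inr (Or.inr (Or.inl (corner ha hc (by linarith) hx1)))
  · exact (no1 ha.le hb hc).elim
  · exact Or.inr (Or.inl (corner hb hc hs hx))
  · exact (no2 hb.le ha hc).elim
  · exact (no3 hc.le ha hb).elim
  · rcases ha.eq_or_lt with ha' | ha'
    · exact (no1 ha'.ge hb hc).elim
    rcases hb.eq_or_lt with hb' | hb'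
    · exact (no2 hb'.ge ha hc).elim
    rcases hc.eq_or_lt with hc' | hc'
    · exact (no3 hc'.ge ha hb).elim
    exact Or.inl ⟨a, b, c, ha', hb', hc', hs, hx⟩

/-- Of two vertices adjacent to all corners of a triangle, one is inside the triangle. -/
theorem IsPlanar.inside_or_inside (hΓ : Γ.IsPlanar) {p q r x y : V} (hpq : G.Adj p q)
    (hqr : G.Adj q r) (hpr : G.Adj p r) (hxp : G.Adj x p) (hxq : G.Adj x q) (hxr : G.Adj x r)
    (hyp : G.Adj y p) (hyq : G.Adj y q) (hyr : G.Adj y r) (hxy : x ≠ y) :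
    Γ.Inside p q r x ∨ Γ.Inside p q r y := by
  rcases hΓ.inside_or_of_adj hpq hqr hpr hxp hxq hxr with h | h | h | h
  · exact Or.inl h
  · exact Or.inr (hΓ.inside_of_stacked hqr hxr.symm hxq.symm hpq.symm hpr.symm hxp h
      hyq hyr hyp hxy.symm).rotate.rotate
  · exact Or.inr (hΓ.inside_of_stacked hpr hxr.symm hxp.symm hpq hqr.symm hxq h
      hyp hyr hyq hxy.symm).rotate.rotate.swap
  · exact Or.inr (hΓ.inside_of_stacked hpq hxq.symm hxp.symm hpr hqr hxr h
      hyp hyq hyr hxy.symm)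

/-- The row of a vertex inside a triangle is strictly between extreme rows of the corners. -/
theorem IsPlanar.row_of_inside (hΓ : Γ.IsPlanar) {p q r w : V} (hpq : G.Adj p q)
    (hqr : G.Adj q r) (hpr : G.Adj p r) (hw : Γ.Inside p q r w) {row : V → ℤ}
    (hrow : ∀ v, (Γ.pos v).2 = row v) :
    (row p < row w ∨ row q < row w ∨ row r < row w) ∧
      (row w < row p ∨ row w < row q ∨ row w < row r) := by
  obtain ⟨a, b, c, ha, hb, hc, hs, hw⟩ := hw
  have hw2 := congrArg Prod.snd hw
  simp only [Prod.snd_add, Prod.smul_snd, smul_eq_mul, hrow] at hw2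
  have hne : ¬ (row p = row w ∧ row q = row w ∧ row r = row w) := by
    rintro ⟨h1, h2, h3⟩
    obtain ⟨x, y, z, hxyz, h⟩ := hΓ.exists_barycentric hpq hqr hpr (0, (row w : ℝ) + 1)
    have h' := congrArg Prod.snd h
    simp only [Prod.snd_add, Prod.smul_snd, smul_eq_mul, hrow, h1, h2, h3] at h'
    have : (x + y + z) * (row w : ℝ) = row w + 1 := by linarith
    rw [hxyz] at this
    linarith
  have key : a * ((row p : ℝ) - row w) + b * ((row q : ℝ) - row w) + c * ((row r : ℝ) - row w)
      = 0 := by linear_combination -hw2 - (row w : ℝ) * hs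
  constructor <;> by_contra! hcon <;> apply hne <;>
    obtain ⟨h1, h2, h3⟩ := hcon <;>
    rify at h1 h2 h3 ⊢ <;>
    refine ⟨?_, ?_, ?_⟩ <;>
    nlinarith

end StraightDrawing

/-- The edges of a gadget: vertex `0` is its connector, `1`, `2`, `3` its outer triangle,
and the remaining vertices are stacked successively into triangles. -/
def gadgetEdges : List (Fin 13 × Fin 13) :=
  [(0, 1), (0, 2), (0, 3), (1, 2), (1, 3), (2, 3), (1, 4), (2, 4), (3, 4), (1, 5), (2, 5), (4, 5),
    (1, 6), (2, 6), (5, 6), (1, 7), (2, 7), (6, 7), (4, 8), (5, 8), (2, 8), (8, 9), (5, 9), (2, 9),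
    (7, 10), (6, 10), (2, 10), (10, 11), (6, 11), (2, 11), (1, 12), (5, 12), (6, 12)]

/-- The `k`-th vertex of the `i`-th gadget. -/
def gadgetVertex (i : Fin 2) (k : Fin 13) : Fin 29 :=
  ⟨3 + 13 * i + k, by omega⟩

/-- The edges of a triangle `0 1 2` together with two gadgets whose connectors are adjacent to all
corners of the triangle, each as a pair sorted increasingly. -/
def doubleGadgetEdges : List (Fin 29 × Fin 29) :=
  [(0, 1), (0, 2), (1, 2)] ++ (List.finRange 2).flatMap fun i =>
    [(0, gadgetVertex i 0), (1, gadgetVertex i 0), (2, gadgetVertex i 0)] ++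
      gadgetEdges.map fun e => (gadgetVertex i e.1, gadgetVertex i e.2)

theorem lt_of_mem_doubleGadgetEdges : ∀ e ∈ doubleGadgetEdges, e.1 < e.2 := by
  have h : (doubleGadgetEdges.all fun e => e.1 < e.2) = true := by decide +kernel
  simpa only [List.all_eq_true, decide_eq_true_eq] using h

/-- The graph with edges `doubleGadgetEdges`. -/
def doubleGadget : SimpleGraph (Fin 29) where
  Adj u v := (u, v) ∈ doubleGadgetEdges ∨ (v, u) ∈ doubleGadgetEdges
  symm := ⟨fun _ _ h => h.symm⟩
  loopless := ⟨fun u h => h.elim (fun h => lt_irrefl u (lt_of_mem_doubleGadgetEdges _ h))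
    fun h => lt_irrefl u (lt_of_mem_doubleGadgetEdges _ h)⟩

theorem doubleGadget_adj_of_gadget (i : Fin 2) {k l : Fin 13}
    (h : (k, l) ∈ gadgetEdges ∨ (l, k) ∈ gadgetEdges) :
    doubleGadget.Adj (gadgetVertex i k) (gadgetVertex i l) := by
  have key : ∀ i : Fin 2, ∀ e ∈ gadgetEdges,
      (gadgetVertex i e.1, gadgetVertex i e.2) ∈ doubleGadgetEdges ∨
        (gadgetVertex i e.2, gadgetVertex i e.1) ∈ doubleGadgetEdges := by decide +kernel
  rcases h with h | h
  · exact key i _ h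
  · exact (key i _ h).symm

theorem doubleGadget_adj_outer : ∀ u v : Fin 29, u < 3 → v < 3 → u ≠ v →
    (u, v) ∈ doubleGadgetEdges ∨ (v, u) ∈ doubleGadgetEdges := by
  decide +kernel

theorem doubleGadget_adj_connector : ∀ (i : Fin 2) (v : Fin 29), v < 3 →
    (gadgetVertex i 0, v) ∈ doubleGadgetEdges ∨ (v, gadgetVertex i 0) ∈ doubleGadgetEdges := by
  decide +kernel

theorem gadgetVertex_ne_of_lt_three (i : Fin 2) (k : Fin 13) {v : Fin 29} (hv : v < 3) :
    gadgetVertex i k ≠ v := by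
  revert i k v
  decide +kernel

theorem gadgetVertex_injective (i : Fin 2) : Function.Injective (gadgetVertex i) := by
  intro k l h
  simpa [gadgetVertex, Fin.ext_iff] using h

/-- A row assignment obeying the constraints imposed by a gadget needs more than four rows. -/
theorem gadget_rows_infeasible {y : Fin 13 → ℤ} {m : ℤ}
    (hy : ∀ k ∈ [1, 2, 3], m ≤ y k ∧ y k ≤ m + 3)
    (hin : ∀ t ∈ ([(1, 2, 3, 4), (1, 2, 4, 5), (1, 2, 5, 6), (1, 2, 6, 7), (2, 4, 5, 8),
        (2, 5, 8, 9), (2, 6, 7, 10), (2, 6, 10, 11), (1, 5, 6, 12)] :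
          List (Fin 13 × Fin 13 × Fin 13 × Fin 13)),
      (y t.1 < y t.2.2.2 ∨ y t.2.1 < y t.2.2.2 ∨ y t.2.2.1 < y t.2.2.2) ∧
        (y t.2.2.2 < y t.1 ∨ y t.2.2.2 < y t.2.1 ∨ y t.2.2.2 < y t.2.2.1)) : False := by
  simp only [List.forall_mem_cons, List.not_mem_nil, false_imp_iff, implies_true, and_true] at hy hin
  obtain ⟨h1, h2, h3⟩ := hy
  obtain ⟨h4, h5, h6, h7, h8, h9, h10, h11, h12⟩ := hin
  have bound {p q r w : ℤ} (hp : m ≤ p ∧ p ≤ m + 3) (hq : m ≤ q ∧ q ≤ m + 3)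
      (hr : m ≤ r ∧ r ≤ m + 3) (h : (p < w ∨ q < w ∨ r < w) ∧ (w < p ∨ w < q ∨ w < r)) :
      (w = m + 1 ∨ w = m + 2) ∧ m ≤ w ∧ w ≤ m + 3 := by
    omega
  have b4 := bound h1 h2 h3 h4
  have b5 := bound h1 h2 b4.2 h5
  have b6 := bound h1 h2 b5.2 h6
  have b7 := bound h1 h2 b6.2 h7
  have wall {b c c' g z : ℤ} (hb : m ≤ b ∧ b ≤ m + 3) (hc : c = m + 1 ∨ c = m + 2)
      (hc' : c' = m + 1 ∨ c' = m + 2) (hg : (b < g ∨ c < g ∨ c' < g) ∧ (g < b ∨ g < c ∨ g < c'))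
      (hz : (b < z ∨ c < z ∨ g < z) ∧ (z < b ∨ z < c ∨ z < g)) :
      (b = m + 3 ∧ c = m + 1) ∨ (b = m ∧ c = m + 2) := by
    clear * - hb hc hc' hg hz
    omega
  have hl := wall h2 b5.1 b4.1 (by clear * - h8; tauto) h9
  have hr := wall h2 b6.1 b7.1 h10 h11
  clear * - h1 hl hr b4 h5 h12
  omega

open StraightDrawing in
/-- `doubleGadget` has no planar straight-line drawing of height 6. -/
theorem doubleGadget_not_straight (Γ : StraightDrawing doubleGadget) (hΓ : Γ.IsPlanar)
    (hh : Γ.HeightLe 6) : False := by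
  choose row hrow1 hrow6 hrow using hh
  have outer (u v : Fin 29) (hu : u < 3) (hv : v < 3) (h : u ≠ v) : doubleGadget.Adj u v :=
    doubleGadget_adj_outer u v hu hv h
  have conn (i : Fin 2) (v : Fin 29) (hv : v < 3) : doubleGadget.Adj (gadgetVertex i 0) v :=
    doubleGadget_adj_connector i v hv
  have o01 := outer 0 1 (by decide) (by decide) (by decide)
  have o12 := outer 1 2 (by decide) (by decide) (by decide)
  have o02 := outer 0 2 (by decide) (by decide) (by decide)
  obtain ⟨i, hi⟩ : ∃ i : Fin 2, Γ.Inside 0 1 2 (gadgetVertex i 0) := by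
    rcases hΓ.inside_or_inside o01 o12 o02 (conn 0 0 (by decide)) (conn 0 1 (by decide))
      (conn 0 2 (by decide)) (conn 1 0 (by decide)) (conn 1 1 (by decide)) (conn 1 2 (by decide))
      (by decide) with h | h
    exacts [⟨_, h⟩, ⟨_, h⟩]
  have ne (k : Fin 13) (v : Fin 29) (hv : v < 3) : gadgetVertex i k ≠ v :=
    gadgetVertex_ne_of_lt_three i k hv
  have ne' (k l : Fin 13) (h : k ≠ l) : gadgetVertex i k ≠ gadgetVertex i l :=
    (gadgetVertex_injective i).ne h
  have adj (k l : Fin 13) (h : (k, l) ∈ gadgetEdges ∨ (l, k) ∈ gadgetEdges) :=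
    doubleGadget_adj_of_gadget i h
  have inner (k : Fin 13) (h : (0, k) ∈ gadgetEdges ∨ (k, 0) ∈ gadgetEdges) :
      Γ.Inside 0 1 2 (gadgetVertex i k) :=
    hΓ.inside_of_adj o01 o12 o02 hi (adj 0 k h) (ne _ _ (by decide)) (ne _ _ (by decide))
      (ne _ _ (by decide)) (ne _ _ (by decide)) (ne _ _ (by decide)) (ne _ _ (by decide))
  have rows (k : Fin 13) (h : (0, k) ∈ gadgetEdges ∨ (k, 0) ∈ gadgetEdges) :=
    hΓ.row_of_inside o01 o12 o02 (inner k h) hrow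
  have r1 := rows 1 (by decide)
  have r2 := rows 2 (by decide)
  have r3 := rows 3 (by decide)
  have a12 := adj 1 2 (by decide)
  have a23 := adj 2 3 (by decide)
  have a13 := adj 1 3 (by decide)
  have hbound (v : Fin 29) := And.intro (hrow1 v) (hrow6 v)
  have b0 := hbound 0
  have b1 := hbound 1
  have b2 := hbound 2
  push_cast at b0 b1 b2
  have hnot : ¬ Γ.Inside (gadgetVertex i 1) (gadgetVertex i 2) (gadgetVertex i 3)
      (gadgetVertex i 0) := by
    intro h
    have corner (v : Fin 29) (hv : v < 3) := hΓ.row_of_inside a12 a23 a13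
      (hΓ.inside_of_adj a12 a23 a13 h (conn i v hv) (ne' _ _ (by decide)) (ne' _ _ (by decide))
        (ne' _ _ (by decide)) (ne _ _ hv).symm (ne _ _ hv).symm (ne _ _ hv).symm) hrow
    have c0 := corner 0 (by decide)
    have c1 := corner 1 (by decide)
    have c2 := corner 2 (by decide)
    omega
  have h4 := (hΓ.inside_or_inside a12 a23 a13 (adj 0 1 (by decide)) (adj 0 2 (by decide))
    (adj 0 3 (by decide)) (adj 4 1 (by decide)) (adj 4 2 (by decide)) (adj 4 3 (by decide))
    (ne' _ _ (by decide))).resolve_left hnot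
  have stacked (p q r s w : Fin 13)
      (hs : Γ.Inside (gadgetVertex i p) (gadgetVertex i q) (gadgetVertex i r) (gadgetVertex i s))
      (hadj : ∀ e ∈ [(p, q), (q, r), (p, r), (p, s), (q, s), (r, s), (w, p), (w, q), (w, s)],
        e ∈ gadgetEdges ∨ e.swap ∈ gadgetEdges) (hwr : w ≠ r) :
      Γ.Inside (gadgetVertex i p) (gadgetVertex i q) (gadgetVertex i s) (gadgetVertex i w) := by
    simp only [List.forall_mem_cons] at hadj
    obtain ⟨e1, e2, e3, e4, e5, e6, e7, e8, e9, -⟩ := hadj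
    exact hΓ.inside_of_stacked (adj _ _ e1) (adj _ _ e2) (adj _ _ e3) (adj _ _ e4) (adj _ _ e5)
      (adj _ _ e6) hs (adj _ _ e7) (adj _ _ e8) (adj _ _ e9) (ne' _ _ hwr)
  have h5 := stacked 1 2 3 4 5 h4 (by decide +kernel) (by decide +kernel)
  have h6 := stacked 1 2 4 5 6 h5 (by decide +kernel) (by decide +kernel)
  have h7 := stacked 1 2 5 6 7 h6 (by decide +kernel) (by decide +kernel)
  have h8 := stacked 2 4 1 5 8 h5.rotate (by decide +kernel) (by decide +kernel)
  have h9 := stacked 2 5 4 8 9 h8.rotate.rotate.swap (by decide +kernel) (by decide +kernel)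
  have h10 := stacked 2 6 1 7 10 h7.rotate (by decide +kernel) (by decide +kernel)
  have h11 := stacked 2 6 7 10 11 h10 (by decide +kernel) (by decide +kernel)
  have h12 := stacked 1 5 2 6 12 h6.swap.rotate (by decide +kernel) (by decide +kernel)
  have row_in (t : Fin 13 × Fin 13 × Fin 13 × Fin 13)
      (hadj : ∀ e ∈ [(t.1, t.2.1), (t.2.1, t.2.2.1), (t.1, t.2.2.1)],
        e ∈ gadgetEdges ∨ e.swap ∈ gadgetEdges)
      (h : Γ.Inside (gadgetVertex i t.1) (gadgetVertex i t.2.1) (gadgetVertex i t.2.2.1)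
        (gadgetVertex i t.2.2.2)) := by
    simp only [List.forall_mem_cons] at hadj
    exact hΓ.row_of_inside (adj _ _ hadj.1) (adj _ _ hadj.2.1) (adj _ _ hadj.2.2.1) h hrow
  apply gadget_rows_infeasible (y := fun k => row (gadgetVertex i k)) (m := 2)
  · simp only [List.forall_mem_cons, List.not_mem_nil, false_imp_iff, implies_true, and_true]
    omega
  · simp only [List.forall_mem_cons, List.not_mem_nil, false_imp_iff, implies_true, and_true]
    exact ⟨row_in (1, 2, 3, 4) (by decide +kernel) h4, row_in (1, 2, 4, 5) (by decide +kernel) h5,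
      row_in (1, 2, 5, 6) (by decide +kernel) h6, row_in (1, 2, 6, 7) (by decide +kernel) h7,
      row_in (2, 4, 5, 8) (by decide +kernel) h8, row_in (2, 5, 8, 9) (by decide +kernel) h9,
      row_in (2, 6, 7, 10) (by decide +kernel) h10, row_in (2, 6, 10, 11) (by decide +kernel) h11,
      row_in (1, 5, 6, 12) (by decide +kernel) h12⟩

theorem chainSet_pair (p q : Pt) : chainSet [p, q] = segment ℝ p q :=
  union_eq_self_of_subset_right (singleton_subset_iff.2 (right_mem_segment ℝ p q))

theorem chainSet_triple (p q r : Pt) : chainSet [p, q, r] = segment ℝ p q ∪ segment ℝ q r :=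
  congrArg _ (chainSet_pair q r)

theorem isSimpleArc_chainSet_pair {p q : Pt} (h : p ≠ q) : IsSimpleArc (chainSet [p, q]) p q :=
  ⟨AffineMap.lineMap p q, AffineMap.lineMap_continuous.continuousOn,
    (AffineMap.lineMap_injective ℝ h).injOn, by rw [chainSet_pair, segment_eq_image_lineMap],
    by simp, by simp⟩

theorem isSimpleArc_chainSet_triple {p q r : Pt}
    (h : (q.1 - p.1) * (r.2 - p.2) - (q.2 - p.2) * (r.1 - p.1) ≠ 0) :
    IsSimpleArc (chainSet [p, q, r]) p r := by
  have hcoord (a b a' b' : ℝ)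
      (e : p + a • (q - p) + b • (r - q) = p + a' • (q - p) + b' • (r - q)) : a = a' ∧ b = b' := by
    obtain ⟨e1, e2⟩ := Prod.ext_iff.1 e
    simp only [Prod.fst_add, Prod.smul_fst, Prod.fst_sub, Prod.snd_add, Prod.smul_snd,
      Prod.snd_sub, smul_eq_mul] at e1 e2
    constructor
    · refine mul_right_cancel₀ h ?_
      linear_combination (r.2 - q.2) * e1 - (r.1 - q.1) * e2
    · refine mul_right_cancel₀ h ?_
      linear_combination (q.1 - p.1) * e2 - (q.2 - p.2) * e1
  refine ⟨fun t => p + min (2 * t) 1 • (q - p) + max (2 * t - 1) 0 • (r - q), by fun_prop,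
    fun s _ t _ hst => ?_, ?_, by simp, by norm_num⟩
  · obtain ⟨e1, e2⟩ := hcoord _ _ _ _ hst
    rcases le_total (2 * s) 1 with hs | hs <;> rcases le_total (2 * t) 1 with ht | ht
    · rw [min_eq_left hs, min_eq_left ht] at e1
      linarith
    · rw [max_eq_right (by linarith), max_eq_left (by linarith)] at e2
      rw [min_eq_left hs, min_eq_right ht] at e1
      linarith
    · rw [max_eq_left (by linarith), max_eq_right (by linarith)] at e2
      rw [min_eq_right hs, min_eq_left ht] at e1
      linarith
    · rw [max_eq_left (by linarith), max_eq_left (by linarith)] at e2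
      linarith
  · rw [chainSet_triple, segment_eq_image', segment_eq_image']
    ext x
    constructor
    · rintro ⟨t, ⟨ht0, ht1⟩, rfl⟩
      rcases le_total (2 * t) 1 with ht | ht
      · left
        refine ⟨2 * t, ⟨by linarith, ht⟩, ?_⟩
        simp [min_eq_left ht, max_eq_right (show 2 * t - 1 ≤ 0 by linarith)]
      · right
        refine ⟨2 * t - 1, ⟨by linarith, by linarith⟩, ?_⟩
        simp [min_eq_right ht, max_eq_left (show 0 ≤ 2 * t - 1 by linarith)]
    · rintro (⟨t, ⟨ht0, ht1⟩, rfl⟩ | ⟨t, ⟨ht0, ht1⟩, rfl⟩)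
      · refine ⟨t / 2, ⟨by linarith, by linarith⟩, ?_⟩
        simp [show 2 * (t / 2) = t by ring, ht1]
      · refine ⟨(t + 1) / 2, ⟨by linarith, by linarith⟩, ?_⟩
        simp [show 2 * ((t + 1) / 2) = t + 1 by ring, ht0]

/-- The point of the plane with the given integer coordinates. -/
def latticePoint (p : ℤ × ℤ) : Pt := ((p.1 : ℝ), (p.2 : ℝ))

theorem latticePoint_injective : Function.Injective latticePoint := fun p q h => by
  simpa [latticePoint, Prod.ext_iff] using h

/-- The value at `p` of the linear functional with coefficients `d`. -/
def latticeForm (d p : ℤ × ℤ) : ℤ := d.1 * p.1 + d.2 * p.2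

/-- The segment `s` is strictly below the segment `t` with respect to the functional `d`. -/
def StrictlyBelow (d : ℤ × ℤ) (s t : (ℤ × ℤ) × (ℤ × ℤ)) : Prop :=
  max (latticeForm d s.1) (latticeForm d s.2) < min (latticeForm d t.1) (latticeForm d t.2)

/-- With respect to the functional `d`, the segment `s` attains its maximum only in the endpoint
`w` and the segment `t` stays weakly above `w`. -/
def TouchesBelow (d w : ℤ × ℤ) (s t : (ℤ × ℤ) × (ℤ × ℤ)) : Prop :=
  (s.1 = w ∧ latticeForm d s.2 < latticeForm d w ∨
    s.2 = w ∧ latticeForm d s.1 < latticeForm d w) ∧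
  latticeForm d w ≤ min (latticeForm d t.1) (latticeForm d t.2)

/-- Functionals normal or parallel to a segment. -/
def axes (s : (ℤ × ℤ) × (ℤ × ℤ)) : List (ℤ × ℤ) :=
  let u := s.2.1 - s.1.1
  let v := s.2.2 - s.1.2
  [(v, -u), (-v, u), (u, v), (-u, -v)]

instance (d : ℤ × ℤ) (s t : (ℤ × ℤ) × (ℤ × ℤ)) : Decidable (StrictlyBelow d s t) := by
  unfold StrictlyBelow; infer_instance

instance (d w : ℤ × ℤ) (s t : (ℤ × ℤ) × (ℤ × ℤ)) : Decidable (TouchesBelow d w s t) := by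
  unfold TouchesBelow; infer_instance

/-- Tests whether one of the `axes` of two lattice segments witnesses that they meet at most in
points of `c`. -/
def meetWithin (c : List (ℤ × ℤ)) (s t : (ℤ × ℤ) × (ℤ × ℤ)) : Bool :=
  (axes s ++ axes t).any fun d =>
    StrictlyBelow d s t || c.any fun w => TouchesBelow d w s t || TouchesBelow d w t s

theorem exists_form_eq_of_mem_segment (d a b : ℤ × ℤ) {p : Pt}
    (hp : p ∈ segment ℝ (latticePoint a) (latticePoint b)) :
    ∃ x y : ℝ, 0 ≤ x ∧ 0 ≤ y ∧ x + y = 1 ∧ p = x • latticePoint a + y • latticePoint b ∧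
      d.1 * p.1 + d.2 * p.2 = x * latticeForm d a + y * latticeForm d b := by
  obtain ⟨x, y, hx, hy, hxy, rfl⟩ := hp
  refine ⟨x, y, hx, hy, hxy, rfl, ?_⟩
  simp only [latticePoint, latticeForm, Prod.fst_add, Prod.smul_fst, Prod.snd_add, Prod.smul_snd,
    smul_eq_mul]
  push_cast
  ring

theorem le_form_of_mem_segment {d a b : ℤ × ℤ} {p : Pt} {m : ℤ}
    (hp : p ∈ segment ℝ (latticePoint a) (latticePoint b))
    (hm : m ≤ min (latticeForm d a) (latticeForm d b)) : (m : ℝ) ≤ d.1 * p.1 + d.2 * p.2 := by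
  obtain ⟨x, y, hx, hy, hxy, -, h⟩ := exists_form_eq_of_mem_segment d a b hp
  have ha : (m : ℝ) ≤ latticeForm d a := by exact_mod_cast (le_min_iff.1 hm).1
  have hb : (m : ℝ) ≤ latticeForm d b := by exact_mod_cast (le_min_iff.1 hm).2
  rw [h]
  calc (m : ℝ) = x * m + y * m := by rw [← add_mul, hxy, one_mul]
    _ ≤ _ := by gcongr

theorem form_le_of_mem_segment {d a b : ℤ × ℤ} {p : Pt} {m : ℤ}
    (hp : p ∈ segment ℝ (latticePoint a) (latticePoint b))
    (hm : max (latticeForm d a) (latticeForm d b) ≤ m) : d.1 * p.1 + d.2 * p.2 ≤ (m : ℝ) := by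
  obtain ⟨x, y, hx, hy, hxy, -, h⟩ := exists_form_eq_of_mem_segment d a b hp
  have ha : (latticeForm d a : ℝ) ≤ m := by exact_mod_cast (max_le_iff.1 hm).1
  have hb : (latticeForm d b : ℝ) ≤ m := by exact_mod_cast (max_le_iff.1 hm).2
  rw [h]
  calc _ ≤ x * m + y * m := by gcongr
    _ = (m : ℝ) := by rw [← add_mul, hxy, one_mul]

theorem eq_of_mem_segment_of_le_form {d a w : ℤ × ℤ} {p : Pt}
    (hp : p ∈ segment ℝ (latticePoint w) (latticePoint a))
    (h : latticeForm d a < latticeForm d w)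
    (hle : (latticeForm d w : ℝ) ≤ d.1 * p.1 + d.2 * p.2) : p = latticePoint w := by
  obtain ⟨x, y, hx, hy, hxy, rfl, e⟩ := exists_form_eq_of_mem_segment d w a hp
  have h' : (latticeForm d a : ℝ) < latticeForm d w := by exact_mod_cast h
  obtain rfl : x = 1 - y := by linarith
  obtain rfl : y = 0 := by nlinarith
  simp

theorem TouchesBelow.eq {d w : ℤ × ℤ} {s t : (ℤ × ℤ) × (ℤ × ℤ)} {p : Pt}
    (h : TouchesBelow d w s t) (hs : p ∈ segment ℝ (latticePoint s.1) (latticePoint s.2))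
    (ht : p ∈ segment ℝ (latticePoint t.1) (latticePoint t.2)) : p = latticePoint w := by
  have hle := le_form_of_mem_segment ht h.2
  rcases h.1 with ⟨rfl, h⟩ | ⟨rfl, h⟩
  · exact eq_of_mem_segment_of_le_form hs h hle
  · exact eq_of_mem_segment_of_le_form (segment_symm ℝ _ (latticePoint s.2) ▸ hs) h hle

theorem exists_eq_of_meetWithin {c : List (ℤ × ℤ)} {s t : (ℤ × ℤ) × (ℤ × ℤ)} {p : Pt}
    (h : meetWithin c s t = true) (hs : p ∈ segment ℝ (latticePoint s.1) (latticePoint s.2))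
    (ht : p ∈ segment ℝ (latticePoint t.1) (latticePoint t.2)) : ∃ w ∈ c, p = latticePoint w := by
  simp only [meetWithin, List.any_eq_true, Bool.or_eq_true, decide_eq_true_eq] at h
  obtain ⟨d, -, h | ⟨w, hw, h | h⟩⟩ := h
  · have h1 := form_le_of_mem_segment (d := d) hs le_rfl
    have h2 := le_form_of_mem_segment (d := d) ht le_rfl
    exact absurd (Int.cast_le.1 (h2.trans h1)) (not_le.2 h)
  · exact ⟨w, hw, h.eq hs ht⟩
  · exact ⟨w, hw, h.eq ht hs⟩

theorem exists_segment_of_mem_chainSet {p : Pt} : ∀ {l : List (ℤ × ℤ)}, 2 ≤ l.length →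
    p ∈ chainSet (l.map latticePoint) →
      ∃ s ∈ l.zip l.tail, p ∈ segment ℝ (latticePoint s.1) (latticePoint s.2)
  | [a, b], _, hp => ⟨(a, b), by simp, by rwa [List.map, List.map, List.map, chainSet_pair] at hp⟩
  | a :: b :: c :: l, _, hp => by
    rcases hp with hp | hp
    · exact ⟨(a, b), by simp, hp⟩
    · obtain ⟨s, hs, h⟩ := exists_segment_of_mem_chainSet (l := b :: c :: l) (by simp) hp
      exact ⟨s, List.mem_cons_of_mem _ hs, h⟩

/-- Coordinates of the vertices of one drawn gadget. -/
def gadgetCoords : List (ℤ × ℤ) :=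
  [(-96, 1), (0, 1), (0, 4), (-62, 2), (-30, 3), (-14, 2), (-10, 2), (-2, 3), (-9, 3), (-8, 3),
    (-3, 3), (-4, 3), (-12, 2)]

/-- Coordinates of the drawn vertices of `doubleGadget`. -/
def drawnVertex (v : Fin 29) : ℤ × ℤ :=
  let upper := gadgetCoords.map fun p => (p.1, p.2 + 1)
  let lower := gadgetCoords.map fun p => (-496 - p.1, p.2)
  ([(10, 1), (10, 6), (-200, 2)] ++ upper ++ lower).getD v 0

/-- The chain drawn for the edge between `u < v`; only one edge of each gadget has a bend. -/
def drawnChain (u v : Fin 29) : List (ℤ × ℤ) :=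
  if u = 8 ∧ v = 9 then [drawnVertex u, (-6, 4), drawnVertex v]
  else if u = 21 ∧ v = 22 then [drawnVertex u, (-490, 3), drawnVertex v]
  else [drawnVertex u, drawnVertex v]

theorem drawnVertex_injective : Function.Injective drawnVertex := by
  unfold Function.Injective
  decide +kernel

theorem drawnVertex_row : ∀ v, 1 ≤ (drawnVertex v).2 ∧ (drawnVertex v).2 ≤ 6 := by
  decide +kernel

/-- The segments of the chain drawn for an edge. -/
def drawnSegments (e : Fin 29 × Fin 29) : List ((ℤ × ℤ) × (ℤ × ℤ)) :=
  (drawnChain e.1 e.2).zip (drawnChain e.1 e.2).tail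

theorem meetWithin_of_ne {e f : Fin 29 × Fin 29} (he : e ∈ doubleGadgetEdges)
    (hf : f ∈ doubleGadgetEdges) (hef : e ≠ f) {s t : (ℤ × ℤ) × (ℤ × ℤ)}
    (hs : s ∈ drawnSegments e) (ht : t ∈ drawnSegments f) :
    meetWithin (([e.1, e.2].filter (· ∈ [f.1, f.2])).map drawnVertex) s t = true := by
  have h : (doubleGadgetEdges.all fun e => doubleGadgetEdges.all fun f => e = f ||
      (drawnSegments e).all fun s => (drawnSegments f).all fun t =>
        meetWithin (([e.1, e.2].filter (· ∈ [f.1, f.2])).map drawnVertex) s t) = true := by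
    decide +kernel
  simp only [List.all_eq_true, Bool.or_eq_true, decide_eq_true_eq] at h
  exact (h e he f hf).resolve_left hef s hs t ht

theorem meetWithin_nil_of_ne {v : Fin 29} {e : Fin 29 × Fin 29} (he : e ∈ doubleGadgetEdges)
    (hv : v ≠ e.1 ∧ v ≠ e.2) {s : (ℤ × ℤ) × (ℤ × ℤ)} (hs : s ∈ drawnSegments e) :
    meetWithin [] (drawnVertex v, drawnVertex v) s = true := by
  have h : ∀ v, (doubleGadgetEdges.all fun e => (v = e.1 || v = e.2) ||
      (drawnSegments e).all (meetWithin [] (drawnVertex v, drawnVertex v))) = true := by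
    decide +kernel
  simp only [List.all_eq_true, Bool.or_eq_true, decide_eq_true_eq] at h
  exact (h v e he).resolve_left (not_or.2 hv) s hs

theorem length_drawnChain (u v : Fin 29) : 2 ≤ (drawnChain u v).length := by
  unfold drawnChain
  split_ifs <;> simp

theorem head?_drawnChain (u v : Fin 29) : (drawnChain u v).head? = some (drawnVertex u) := by
  unfold drawnChain
  split_ifs <;> rfl

theorem getLast?_drawnChain (u v : Fin 29) :
    (drawnChain u v).getLast? = some (drawnVertex v) := by
  unfold drawnChain
  split_ifs <;> rfl

theorem bend_row {u v : Fin 29} {p : ℤ × ℤ} (h : p ∈ ((drawnChain u v).drop 1).dropLast) :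
    1 ≤ p.2 ∧ p.2 ≤ 6 := by
  unfold drawnChain at h
  split_ifs at h <;> simp at h <;> simp [h]

theorem isSimpleArc_drawnChain {u v : Fin 29} (h : u ≠ v) :
    IsSimpleArc (chainSet ((drawnChain u v).map latticePoint)) (latticePoint (drawnVertex u))
      (latticePoint (drawnVertex v)) := by
  unfold drawnChain
  split_ifs with h1 h2
  · obtain ⟨rfl, rfl⟩ := h1
    exact isSimpleArc_chainSet_triple (by norm_num [latticePoint, drawnVertex, gadgetCoords])
  · obtain ⟨rfl, rfl⟩ := h2
    exact isSimpleArc_chainSet_triple (by norm_num [latticePoint, drawnVertex, gadgetCoords])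
  · exact isSimpleArc_chainSet_pair ((latticePoint_injective.comp drawnVertex_injective).ne h)

theorem exists_mem_doubleGadgetEdges {e : Sym2 (Fin 29)} (he : e ∈ doubleGadget.edgeSet) :
    ∃ q ∈ doubleGadgetEdges, e = s(q.1, q.2) ∧ e.inf = q.1 ∧ e.sup = q.2 := by
  induction e with
  | _ u v =>
    rcases he with h | h
    · have := (lt_of_mem_doubleGadgetEdges _ h).le
      exact ⟨(u, v), h, rfl, by simpa using this, by simpa using this⟩
    · have := (lt_of_mem_doubleGadgetEdges _ h).le
      exact ⟨(v, u), h, Sym2.eq_swap, by simpa using this, by simpa using this⟩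

/-- A drawing of `doubleGadget` with one bend in each gadget. -/
def doubleGadgetDrawing : PolyDrawing doubleGadget where
  pos v := latticePoint (drawnVertex v)
  pos_inj := latticePoint_injective.comp drawnVertex_injective
  arc e := (drawnChain e.inf e.sup).map latticePoint
  arc_ends u v _ := by
    rw [Sym2.inf_mk, Sym2.sup_mk]
    simp only [List.head?_map, List.getLast?_map, head?_drawnChain, getLast?_drawnChain]
    rcases le_total u v with h | h <;> simp [h]
  arc_simple u v h := by
    rw [Sym2.inf_mk, Sym2.sup_mk]
    rcases le_total u v with h' | h'
    · rw [inf_eq_left.2 h', sup_eq_right.2 h']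
      exact isSimpleArc_drawnChain h.ne
    · rw [inf_eq_right.2 h', sup_eq_left.2 h']
      exact (isSimpleArc_drawnChain h.ne').symm

theorem doubleGadgetDrawing_isPlanar : doubleGadgetDrawing.IsPlanar := by
  constructor
  · intro v e he hv hp
    obtain ⟨q, hq, rfl, hi, hs⟩ := exists_mem_doubleGadgetEdges he
    change _ ∈ chainSet ((drawnChain _ _).map latticePoint) at hp
    rw [hi, hs] at hp
    obtain ⟨s, hs, hp⟩ := exists_segment_of_mem_chainSet (length_drawnChain _ _) hp
    have hne : v ≠ q.1 ∧ v ≠ q.2 := by simpa using hv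
    obtain ⟨w, hw, -⟩ := exists_eq_of_meetWithin (meetWithin_nil_of_ne hq hne hs)
      (left_mem_segment ℝ _ _) hp
    simp at hw
  · rintro e he f hf hne p ⟨hpe, hpf⟩
    obtain ⟨q, hq, rfl, hi, hs⟩ := exists_mem_doubleGadgetEdges he
    obtain ⟨r, hr, rfl, hi', hs'⟩ := exists_mem_doubleGadgetEdges hf
    change p ∈ chainSet ((drawnChain _ _).map latticePoint) at hpe hpf
    rw [hi, hs] at hpe
    rw [hi', hs'] at hpf
    obtain ⟨s, hs, hpe⟩ := exists_segment_of_mem_chainSet (length_drawnChain _ _) hpe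
    obtain ⟨t, ht, hpf⟩ := exists_segment_of_mem_chainSet (length_drawnChain _ _) hpf
    have hqr : q ≠ r := fun h => hne (by rw [h])
    obtain ⟨_, hc, rfl⟩ := exists_eq_of_meetWithin (meetWithin_of_ne hq hr hqr hs ht) hpe hpf
    obtain ⟨w, hw, rfl⟩ := List.mem_map.1 hc
    obtain ⟨hwq, hwr⟩ := List.mem_filter.1 hw
    exact ⟨w, by simpa using hwq, by simpa using hwr, rfl⟩

theorem doubleGadgetDrawing_hasHeight : doubleGadgetDrawing.HasHeight 6 := by
  constructor
  · intro v
    exact ⟨_, (drawnVertex_row v).1, (drawnVertex_row v).2, rfl⟩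
  · intro e _ p hp
    simp only [doubleGadgetDrawing, chainBends, ← List.map_drop, ← List.map_dropLast] at hp
    obtain ⟨a, ha, rfl⟩ := List.mem_map.1 hp
    exact ⟨a.2, (bend_row ha).1, (bend_row ha).2, rfl⟩

/-- There is a (finite) simple graph admitting a planar poly-line
drawing of height 6 but no planar straight-line drawing in which every vertex has an
integer `y`-coordinate in `{1, …, 6}`. -/
theorem stmt11 :
    ∃ (V : Type) (_ : Fintype V) (G : SimpleGraph V),
      (∃ Γ : PolyDrawing G, Γ.IsPlanar ∧ Γ.HasHeight 6) ∧
      ¬ ∃ Γ : StraightDrawing G, Γ.IsPlanar ∧ Γ.HeightLe 6 :=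
  ⟨Fin 29, inferInstance, doubleGadget,
    ⟨doubleGadgetDrawing, doubleGadgetDrawing_isPlanar, doubleGadgetDrawing_hasHeight⟩,
    fun ⟨Γ, hΓ, hh⟩ => doubleGadget_not_straight Γ hΓ hh⟩
end
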